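/- Variance of Liouville in short intervals over F_q[t]: for fixed q, if h ≪ √N and h(N) → ∞ as N → ∞, then (1/q^N) Σ_{G₀ ∈ M_N} |Σ_{G ∈ I_h(G₀)} λ(G)|² ≪_q (N⁵/h²)·q^h. -/

import Mathlib

open Polynomial Finset Filter
open scoped Classical

/-- The set of monic polynomials of degree `n` over `Fq`. -/
noncomputable def Mn (Fq : Type) [Field Fq] [Fintype Fq] (n : ℕ) : Finset (Polynomial Fq) :=
  (Finset.univ : Finset (Fin n → Fq)).image
    (fun c => Polynomial.X ^ n + ∑ i : Fin n, Polynomial.C (c i) * Polynomial.X ^ (i : ℕ))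

/-- The set of monic irreducible polynomials of degree `x` over `Fq`. -/
noncomputable def Px (Fq : Type) [Field Fq] [Fintype Fq] (x : ℕ) : Finset (Polynomial Fq) :=
  (Mn Fq x).filter Irreducible

/-- `Mn` extended to integer degrees: empty for negative degree. -/
noncomputable def MnInt (Fq : Type) [Field Fq] [Fintype Fq] (m : ℤ) : Finset (Polynomial Fq) :=
  if 0 ≤ m then Mn Fq m.toNat else ∅

/-- The Liouville function on `Fq[t]`: `(-1)` to the number of irreducible
factors counted with multiplicity. -/
noncomputable def liouville {Fq : Type} [Field Fq] [Fintype Fq] (G : Polynomial Fq) : ℤ :=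
  (-1) ^ Multiset.card (UniqueFactorizationMonoid.factors G)

/-- The residue ring `Fq[t]/(Q)`. -/
abbrev RQ (Fq : Type) [Field Fq] [Fintype Fq] (Q : Polynomial Fq) :=
  Polynomial Fq ⧸ Ideal.span {Q}

/-- Value of a Dirichlet character mod `Q` at a polynomial. -/
noncomputable def chpoly {Fq : Type} [Field Fq] [Fintype Fq] {Q : Polynomial Fq}
    (χ : MulChar (RQ Fq Q) ℂ) (G : Polynomial Fq) : ℂ :=
  χ (Ideal.Quotient.mk (Ideal.span {Q}) G)

/-- A Dirichlet character is even if it is invariant under multiplication by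
nonzero constants. -/
noncomputable def IsEvenChar {Fq : Type} [Field Fq] [Fintype Fq] {Q : Polynomial Fq}
    (χ : MulChar (RQ Fq Q) ℂ) : Prop :=
  ∀ (c : Fqˣ) (G : Polynomial Fq), chpoly χ (Polynomial.C (c : Fq) * G) = chpoly χ G

/-- Euler's function for polynomial moduli: `φ(Q) = |(Fq[t]/Q)ˣ|`. -/
noncomputable def phi (Fq : Type) [Field Fq] [Fintype Fq] (Q : Polynomial Fq) : ℕ :=
  Nat.card (Polynomial Fq ⧸ Ideal.span {Q})ˣ

/-- A polynomial is `h`-smooth if all of its irreducible factors have degree at most `h`. -/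
def IsSmooth {Fq : Type} [Field Fq] [Fintype Fq] (h : ℕ) (G : Polynomial Fq) : Prop :=
  ∀ P : Polynomial Fq, Irreducible P → P ∣ G → P.natDegree ≤ h

/-- The von Mangoldt function on `Fq[t]`: `Λ(P^k) = deg P` for `P` monic
irreducible and `k ≥ 1`, and `Λ = 0` otherwise. -/
noncomputable def Lam {Fq : Type} [Field Fq] [Fintype Fq] (G : Polynomial Fq) : ℕ :=
  if hG : ∃ P : Polynomial Fq, P.Monic ∧ Irreducible P ∧ ∃ k, 1 ≤ k ∧ G = P ^ k
  then hG.choose.natDegree else 0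

/-- `ω_{[h,n]}(M)`: number of distinct monic irreducible divisors of `M` of degree in `[h,n]`. -/
noncomputable def omegaIcc {Fq : Type} [Field Fq] [Fintype Fq] (h n : ℕ) (M : Polynomial Fq) : ℕ :=
  (((Finset.Icc h n).biUnion (Px Fq)).filter (· ∣ M)).card

/-- `ω_{(h,n]}(M)`: number of distinct monic irreducible divisors of `M` of degree in `(h,n]`. -/
noncomputable def omegaIoc {Fq : Type} [Field Fq] [Fintype Fq] (h n : ℕ) (M : Polynomial Fq) : ℕ :=
  (((Finset.Ioc h n).biUnion (Px Fq)).filter (· ∣ M)).card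

/-- The polynomials of degree at most `h`. -/
noncomputable def Dle (Fq : Type) [Field Fq] [Fintype Fq] (h : ℕ) : Finset (Polynomial Fq) :=
  (Finset.univ : Finset (Fin (h + 1) → Fq)).image
    (fun c => ∑ i : Fin (h + 1), Polynomial.C (c i) * Polynomial.X ^ (i : ℕ))

/-- The short interval of length `h` about `G₀`: all `G` with `deg (G - G₀) ≤ h`. -/
noncomputable def Ih {Fq : Type} [Field Fq] [Fintype Fq] (h : ℕ) (G₀ : Polynomial Fq) :
    Finset (Polynomial Fq) :=
  (Dle Fq h).image (fun E => G₀ + E)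

open Polynomial Finset Filter
open scoped Classical
namespace LV

/-! ### Abstract Stepanov argument -/
section stepanov
variable {k : Type} [Field k] {O : Type} [CommRing O] [Algebra k O]
  {Γ : Type} [LinearOrderedCommGroupWithZero Γ]

lemma val_sum (v : Valuation O Γ) (γ : Γ) (hγ : 1 < γ)
    (hk : ∀ c : k, c ≠ 0 → v (algebraMap k O c) = 1) {ι : Type} (T : Finset ι) (c : ι → k)
    (x : ι → O) (w : ι → ℕ) (hw : Set.InjOn w T) (hx : ∀ i ∈ T, v (x i) = γ ^ w i)
    (hc : ∃ i ∈ T, c i ≠ 0) :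
    ∃ i ∈ T, c i ≠ 0 ∧ v (∑ i ∈ T, c i • x i) = γ ^ w i ∧ ∀ j ∈ T, c j ≠ 0 → w j ≤ w i := by
  have hne : (T.filter (fun i => c i ≠ 0)).Nonempty := by
    obtain ⟨i, hi, h⟩ := hc; exact ⟨i, by simp [hi, h]⟩
  obtain ⟨i, hi, hmax⟩ := Finset.exists_max_image _ w hne
  simp only [Finset.mem_filter] at hi hmax
  have hvc : ∀ j ∈ T, c j ≠ 0 → v (c j • x j) = γ ^ w j := by
    intro j hj hcj
    rw [Algebra.smul_def, map_mul, hk _ hcj, one_mul, hx j hj]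
  have hpos : (0 : Γ) < γ := lt_trans zero_lt_one hγ
  refine ⟨i, hi.1, hi.2, ?_, fun j hj hcj => hmax j ⟨hj, hcj⟩⟩
  rw [Valuation.map_sum_eq_of_lt v hi.1, hvc i hi.1 hi.2]
  intro j hj
  simp only [Finset.mem_sdiff, Finset.mem_singleton] at hj
  rw [hvc i hi.1 hi.2]
  by_cases hcj : c j = 0
  · simp only [hcj, zero_smul, map_zero]; exact pow_pos hpos _
  · rw [hvc j hj.1 hcj]
    apply pow_lt_pow_right₀ hγ
    exact lt_of_le_of_ne (hmax j ⟨hj.1, hcj⟩) (fun h => hj.2 (hw hj.1 hi.1 h))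

/-- the elements of `S` up to `n` -/
noncomputable def SF (S : Set ℕ) (n : ℕ) : Finset ℕ := (Finset.range (n + 1)).filter (· ∈ S)

lemma mem_SF {S : Set ℕ} {n s : ℕ} : s ∈ SF S n ↔ s ≤ n ∧ s ∈ S := by
  simp [SF]

lemma SF_card_add (S : Set ℕ) (b D : ℕ) : (SF S (b + D)).card ≤ (SF S b).card + D := by
  have : SF S (b + D) ⊆ SF S b ∪ Finset.Ioc b (b + D) := by
    intro s hs
    simp only [mem_SF, Finset.mem_union, Finset.mem_Ioc] at *
    by_cases h : s ≤ b
    · left; exact ⟨h, hs.2⟩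
    · right; omega
  calc _ ≤ _ := Finset.card_le_card this
    _ ≤ _ := Finset.card_union_le _ _
    _ = _ := by simp

lemma SF_card (S : Set ℕ) (c0 : ℕ) (hS : ∀ n, c0 ≤ n → n ∈ S) (n : ℕ) (hn : c0 ≤ n) :
    (SF S n).card + ((Finset.range c0).filter (· ∉ S)).card = n + 1 := by
  have h1 : (Finset.range c0).filter (· ∉ S) = (Finset.range (n + 1)).filter (· ∉ S) := by
    ext s
    simp only [Finset.mem_filter, Finset.mem_range]
    constructor
    · rintro ⟨h, h'⟩; exact ⟨by omega, h'⟩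
    · rintro ⟨h, h'⟩; exact ⟨by by_contra hc; exact h' (hS s (by omega)), h'⟩
  rw [h1, SF, Finset.card_filter_add_card_filter_not]; simp

/-- the filtration -/
noncomputable def VV (k : Type) [Field k] {O : Type} [CommRing O] [Algebra k O] (S : Set ℕ)
    (t : ℕ → O) (n : ℕ) : Submodule k O :=
  Submodule.span k (t '' (SF S n : Set ℕ))

structure Data (v : Valuation O Γ) (γ : Γ) (S : Set ℕ) (t : ℕ → O) (k : Type) [Field k]
    [Algebra k O] : Prop where
  hγ : 1 < γ
  hk : ∀ c : k, c ≠ 0 → v (algebraMap k O c) = 1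
  hv : ∀ s ∈ S, v (t s) = γ ^ s
  hspan : ∀ f : O, f ∈ Submodule.span k (t '' S)

variable {v : Valuation O Γ} {γ : Γ} {S : Set ℕ} {t : ℕ → O}

lemma mem_VV {n : ℕ} {f : O} : f ∈ VV k S t n ↔ ∃ c : ℕ → k, ∑ s ∈ SF S n, c s • t s = f := by
  rw [VV, Submodule.mem_span_image_finset_iff_exists_fun']

lemma VV_mono {n n' : ℕ} (h : n ≤ n') : VV k S t n ≤ VV k S t n' := by
  apply Submodule.span_mono
  apply Set.image_mono
  intro s hs
  simp only [Finset.mem_coe, mem_SF] at *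
  exact ⟨hs.1.trans h, hs.2⟩

lemma Data.exists_VV (D : Data v γ S t k) (f : O) : ∃ n, f ∈ VV k S t n := by
  induction D.hspan f using Submodule.span_induction with
  | mem x hx =>
    obtain ⟨s, hs, rfl⟩ := hx
    exact ⟨s, Submodule.subset_span ⟨s, by simp [mem_SF, hs], rfl⟩⟩
  | zero => exact ⟨0, Submodule.zero_mem _⟩
  | add x y _ _ hx hy =>
    obtain ⟨n, hn⟩ := hx
    obtain ⟨n', hn'⟩ := hy
    exact ⟨max n n', Submodule.add_mem _ (VV_mono (le_max_left _ _) hn)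
      (VV_mono (le_max_right _ _) hn')⟩
  | smul a x _ hx =>
    obtain ⟨n, hn⟩ := hx
    exact ⟨n, Submodule.smul_mem _ _ hn⟩

lemma Data.mem_VV_of_le (D : Data v γ S t k) (f : O) (n : ℕ) (hf : v f ≤ γ ^ n) :
    f ∈ VV k S t n := by
  obtain ⟨n', hn'⟩ := D.exists_VV f
  obtain ⟨c, rfl⟩ := mem_VV.1 hn'
  by_cases hc : ∃ s ∈ SF S n', c s ≠ 0
  · obtain ⟨i, hi, hci, hvi, hmax⟩ := val_sum v γ D.hγ D.hk (SF S n') c t id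
      (Function.injective_id.injOn) (fun s hs => D.hv s (mem_SF.1 hs).2) hc
    rw [hvi] at hf
    have hin : i ≤ n := by
      by_contra hlt
      exact absurd hf (not_le.2 (pow_lt_pow_right₀ D.hγ (not_le.1 hlt)))
    apply Submodule.sum_mem
    intro s hs
    by_cases hcs : c s = 0
    · simp [hcs]
    · apply Submodule.smul_mem
      exact Submodule.subset_span ⟨s, by
        simp only [Finset.mem_coe, mem_SF]
        exact ⟨(hmax s hs hcs).trans hin, (mem_SF.1 hs).2⟩, rfl⟩
  · push Not at hc
    rw [Finset.sum_eq_zero]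
    · exact Submodule.zero_mem _
    · intro s hs; rw [hc s hs, zero_smul]

lemma Data.val_le_of_mem (D : Data v γ S t k) (f : O) (n : ℕ) (hf : f ∈ VV k S t n) :
    v f ≤ γ ^ n := by
  obtain ⟨c, rfl⟩ := mem_VV.1 hf
  apply Valuation.map_sum_le
  intro s hs
  rw [Algebra.smul_def, map_mul, D.hv s (mem_SF.1 hs).2]
  have h2 : γ ^ s ≤ γ ^ n := pow_le_pow_right₀ D.hγ.le (mem_SF.1 hs).1
  by_cases hc : c s = 0
  · simp [hc]
  · rw [D.hk _ hc, one_mul]; exact h2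

lemma Data.eq_zero (D : Data v γ S t k) (f : O) (hf : v f = 0) : f = 0 := by
  obtain ⟨n', hn'⟩ := D.exists_VV f
  obtain ⟨c, rfl⟩ := mem_VV.1 hn'
  by_cases hc : ∃ s ∈ SF S n', c s ≠ 0
  · obtain ⟨i, hi, hci, hvi, hmax⟩ := val_sum v γ D.hγ D.hk (SF S n') c t id
      (Function.injective_id.injOn) (fun s hs => D.hv s (mem_SF.1 hs).2) hc
    rw [hvi] at hf
    exact absurd hf (pow_pos (lt_trans zero_lt_one D.hγ) _).ne'
  · push Not at hc
    exact Finset.sum_eq_zero (fun s hs => by rw [hc s hs, zero_smul])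

lemma Data.finrank_VV (D : Data v γ S t k) (n : ℕ) :
    Module.finrank k (VV k S t n) = (SF S n).card := by
  have hli : LinearIndependent k (fun s : SF S n => t s) := by
    rw [Fintype.linearIndependent_iff]
    intro g hg i
    by_contra hgi
    obtain ⟨j, hj, hcj, hvj, -⟩ := val_sum v γ D.hγ D.hk (Finset.univ : Finset (SF S n)) g
      (fun s => t s) (fun s => (s : ℕ)) (Subtype.val_injective.injOn)
      (fun s _ => D.hv s (mem_SF.1 s.2).2) ⟨i, Finset.mem_univ _, hgi⟩
    rw [hg, map_zero] at hvj
    exact absurd hvj.symm (pow_pos (lt_trans zero_lt_one D.hγ) _).ne'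
  have := finrank_span_eq_card hli
  rw [Fintype.card_coe] at this
  rw [← this, VV]
  have he : t '' (SF S n : Set ℕ) = Set.range (fun s : SF S n => t s) := by
    rw [Set.image_eq_range]; rfl
  rw [he]

instance (n : ℕ) : FiniteDimensional k (VV k S t n) := by
  unfold VV
  exact FiniteDimensional.span_of_finite k ((SF S n).finite_toSet.image _)

lemma Data.zeros (D : Data v γ S t k) {ι : Type} [Fintype ι] (ev : O →ₐ[k] (ι → k))
    (hev : Function.Surjective ev) (h : O) (d : ℕ) (h0 : v h ≠ 0) (hd : v h ≤ γ ^ d)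
    (hz : ev h = 0) : Fintype.card ι ≤ d := by
  choose f hf using fun i : ι => hev (Pi.single i 1)
  choose nn hn using fun i => D.exists_VV (f i)
  set b := Finset.univ.sup nn with hb
  have hfb : ∀ i, f i ∈ VV k S t (b + d) := fun i =>
    VV_mono (le_trans (Finset.le_sup (f := nn) (Finset.mem_univ i)) (by omega)) (hn i)
  let φ : VV k S t (b + d) →ₗ[k] (ι → k) := ev.toLinearMap.comp (Submodule.subtype _)
  have hφ : Function.Surjective φ := by
    intro g
    refine ⟨∑ i, g i • ⟨f i, hfb i⟩, ?_⟩
    simp only [map_sum, map_smul]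
    ext j
    simp [φ, hf, Pi.single_apply]
  have hr := LinearMap.finrank_range_add_finrank_ker φ
  rw [LinearMap.range_eq_top.2 hφ, finrank_top, Module.finrank_fintype_fun_eq_card,
    D.finrank_VV] at hr
  have hmul : ∀ x : VV k S t b, h * (x : O) ∈ VV k S t (b + d) := by
    intro x
    apply D.mem_VV_of_le
    rw [map_mul, pow_add, mul_comm]
    exact mul_le_mul' (D.val_le_of_mem _ _ x.2) hd
  let θ : VV k S t b →ₗ[k] LinearMap.ker φ :=
    { toFun := fun x => ⟨⟨h * (x : O), hmul x⟩, by
        rw [LinearMap.mem_ker]; simp [φ, hz]⟩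
      map_add' := fun x y => by ext; simp [mul_add]
      map_smul' := fun c x => by ext; simp }
  have hθ : Function.Injective θ := by
    rw [injective_iff_map_eq_zero]
    intro x hx
    have h1 : h * (x : O) = 0 := congrArg (fun z : LinearMap.ker φ => ((z : VV k S t (b + d)) : O)) hx
    have h2 : v h * v (x : O) = 0 := by rw [← map_mul, h1, map_zero]
    have h3 := (mul_eq_zero.1 h2).resolve_left h0
    exact Subtype.ext (D.eq_zero _ h3)
  have hle := LinearMap.finrank_le_finrank_of_injective hθ
  rw [D.finrank_VV] at hle
  have := SF_card_add S b d
  omega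

theorem Data.stepanov (D : Data v γ S t k) [PerfectField k] (p : ℕ) [ExpChar k p] {ι : Type}
    [Fintype ι] (ev : O →ₐ[k] (ι → k)) (hev : Function.Surjective ev) (τ : ℕ → O)
    (hτ : ∀ s ∈ S, v (τ s) = γ ^ s) (μ P : ℕ) (hP : P = p ^ μ)
    (hτev : ∀ s ∈ S, ∀ i, ev (τ s) i ^ (P * P) = ev (t s) i)
    (c0 g : ℕ) (hS : ∀ n, c0 ≤ n → n ∈ S) (hg : g = ((Finset.range c0).filter (· ∉ S)).card)
    (hP1 : c0 + 1 ≤ P) (hP2 : (g + 1) ^ 2 < P) :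
    Fintype.card ι ≤ P * P + (2 * g + 1) * P := by
  set l := P - 1 with hl
  set a := P + 2 * g with ha
  have hlP : l + 1 = P := by omega
  let I := SF S l ×ˢ SF S a
  let L0 : (I → k) →ₗ[k] O := Fintype.linearCombination k (fun i : I => t i.1.1 ^ P * t i.1.2)
  have hL0 : ∀ d, L0 d ∈ VV k S t (l * P + a) := by
    intro d
    rw [Fintype.linearCombination_apply]
    apply Submodule.sum_mem
    intro i _
    apply Submodule.smul_mem
    apply D.mem_VV_of_le
    have hi := Finset.mem_product.1 i.2
    rw [map_mul, map_pow, D.hv _ (mem_SF.1 hi.1).2, D.hv _ (mem_SF.1 hi.2).2, ← pow_mul, ← pow_add]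
    apply pow_le_pow_right₀ D.hγ.le
    have := (mem_SF.1 hi.1).1
    have := (mem_SF.1 hi.2).1
    gcongr
  let L : (I → k) →ₗ[k] VV k S t (l * P + a) := L0.codRestrict _ hL0
  have hker : LinearMap.ker L ≠ ⊥ := by
    apply LinearMap.ker_ne_bot_of_finrank_lt
    rw [D.finrank_VV, Module.finrank_fintype_fun_eq_card, Fintype.card_coe, Finset.card_product]
    have h1 := SF_card S c0 hS l (by omega)
    have h2 := SF_card S c0 hS a (by omega)
    have h3 := SF_card S c0 hS (l * P + a) (by nlinarith)
    rw [← hg] at h1 h2 h3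
    have e1 : (SF S l).card + g = P := by omega
    have e2 : (SF S a).card = P + g + 1 := by omega
    have e3 : (SF S (l * P + a)).card + g = l * P + P + 2 * g + 1 := by omega
    have e4 : l * P + P = P * P := by rw [← hlP]; ring
    rw [e2]
    nlinarith
  obtain ⟨c, hc, hc0⟩ := Submodule.exists_mem_ne_zero_of_ne_bot hker
  have hLc : ∑ i : I, c i • (t i.1.1 ^ P * t i.1.2) = 0 := by
    have := congrArg Subtype.val (LinearMap.mem_ker.1 hc)
    simpa [L, L0, Fintype.linearCombination_apply] using this
  have : PerfectRing k p := PerfectField.toPerfectRing p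
  choose r hr using fun i : I => (bijective_iterateFrobenius k p μ).2 (c i)
  have hr' : ∀ i, r i ^ P = c i := by
    intro i; rw [← hr i, iterateFrobenius_def, hP]
  have hPpos : 0 < P := by omega
  let h : O := ∑ i : I, r i • (t i.1.1 * τ i.1.2 ^ P)
  obtain ⟨i0, hi0⟩ := Function.ne_iff.1 hc0
  have hri0 : r i0 ≠ 0 := by
    intro h0; apply hi0; rw [← hr', h0, zero_pow hPpos.ne']; rfl
  obtain ⟨j, -, hj, hvj, -⟩ := val_sum v γ D.hγ D.hk (Finset.univ : Finset I) r
    (fun i => t i.1.1 * τ i.1.2 ^ P) (fun i => i.1.1 + i.1.2 * P) (by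
      intro i _ i' _ hii
      have hi := (mem_SF.1 (Finset.mem_product.1 i.2).1).1
      have hi' := (mem_SF.1 (Finset.mem_product.1 i'.2).1).1
      simp only at hii
      have m1 := congrArg (· % P) hii
      have m2 := congrArg (· / P) hii
      simp only [Nat.add_mul_mod_self_right, Nat.add_mul_div_right _ _ hPpos] at m1 m2
      rw [Nat.mod_eq_of_lt (by omega), Nat.mod_eq_of_lt (by omega)] at m1
      rw [Nat.div_eq_of_lt (by omega), Nat.div_eq_of_lt (by omega)] at m2
      exact Subtype.ext (Prod.ext m1 (by omega))) (by
      intro i _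
      have hi := Finset.mem_product.1 i.2
      rw [map_mul, map_pow, D.hv _ (mem_SF.1 hi.1).2, hτ _ (mem_SF.1 hi.2).2, ← pow_mul,
        ← pow_add]) ⟨i0, Finset.mem_univ _, hri0⟩
  have hfin := D.zeros ev hev h (l + a * P) (by
      rw [show v h = _ from hvj]
      exact (pow_pos (lt_trans zero_lt_one D.hγ) _).ne') (by
      rw [show v h = _ from hvj]
      apply pow_le_pow_right₀ D.hγ.le
      have hi := Finset.mem_product.1 j.2
      have := (mem_SF.1 hi.1).1
      have := (mem_SF.1 hi.2).1
      gcongr) (by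
      ext x
      have hp : ev h x ^ P = 0 := by
        have h1 : ev h x = ∑ i : I, r i * (ev (t i.1.1) x * ev (τ i.1.2) x ^ P) := by
          simp [h]
        rw [h1, hP, sum_pow_char_pow p, ← hP]
        have h2 := congrFun (congrArg ev hLc) x
        simp only [map_sum, map_smul, map_mul, map_pow, map_zero, Finset.sum_apply, Pi.smul_apply,
          Pi.mul_apply, Pi.pow_apply, Pi.zero_apply, smul_eq_mul] at h2
        rw [← h2]
        apply Finset.sum_congr rfl
        intro i _
        have hi := Finset.mem_product.1 i.2
        rw [mul_pow, mul_pow, hr', ← pow_mul, hτev _ (mem_SF.1 hi.2).2]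
      exact pow_eq_zero_iff hPpos.ne' |>.1 hp)
  nlinarith

end stepanov
end LV

open Polynomial Finset Filter
open scoped Classical
namespace LV

/-! ### The Artin-Schreier-Witt tower -/

lemma exists_val (k : Type) [Field k] [IsAlgClosed k] :
    ∃ (K : Type) (_ : Field K) (_ : Algebra k K) (_ : IsAlgClosed K) (Γ : Type)
      (_ : LinearOrderedCommGroupWithZero Γ) (v : Valuation K Γ) (x : K),
      (∀ c : k, c ≠ 0 → v (algebraMap k K c) = 1) ∧ 1 < v x := by
  let K := AlgebraicClosure (RatFunc k)
  let x : K := algebraMap (RatFunc k) K RatFunc.X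
  let R : Subring K := (algebraMap k K).range
  have hIntCl : IsIntegrallyClosedIn R K := by
    rw [Subring.isIntegrallyClosedIn_iff]
    rintro y ⟨p, hp, hpy⟩
    have hy : IsIntegral k y := by
      have h1 : IsIntegral R y := ⟨p, hp, hpy⟩
      have h2 : Function.Surjective (algebraMap k K).rangeRestrict :=
        (algebraMap k K).rangeRestrict_surjective
      obtain ⟨p', hp', _, hm⟩ := Polynomial.lifts_and_natDegree_eq_and_monic
        (f := (algebraMap k K).rangeRestrict) (p := p)
        (by rw [Polynomial.lifts_iff_coeff_lifts]; intro n; exact h2 _) hp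
      refine ⟨p', hm, ?_⟩
      rw [← hpy, ← hp', Polynomial.eval₂_map]
      rfl
    have h1 := IsAlgClosed.degree_eq_one_of_irreducible k (minpoly.irreducible hy)
    exact minpoly.mem_range_of_degree_eq_one k y h1
  have hx : x ∉ R := by
    rintro ⟨c, hc⟩
    have h1 : algebraMap (RatFunc k) K (algebraMap k (RatFunc k) c) = algebraMap (RatFunc k) K RatFunc.X := by
      rw [← IsScalarTower.algebraMap_apply]; exact hc
    have h2 := (algebraMap (RatFunc k) K).injective h1
    rw [← RatFunc.algebraMap_X, IsScalarTower.algebraMap_apply k (Polynomial k) (RatFunc k)] at h2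
    have h3 := IsFractionRing.injective (Polynomial k) (RatFunc k) h2
    have h4 := congrArg Polynomial.natDegree h3
    simp at h4
  obtain ⟨V, hRV, hxV⟩ := Subring.exists_le_valuationSubring_of_isIntegrallyClosedIn hx
  refine ⟨K, inferInstance, inferInstance, inferInstance, V.ValueGroup, inferInstance, V.valuation,
    x, ?_, ?_⟩
  · intro c hc
    have h1 : V.valuation (algebraMap k K c) ≤ 1 :=
      (V.valuation_le_one_iff _).2 (hRV ⟨c, rfl⟩)
    have h2 : V.valuation (algebraMap k K c⁻¹) ≤ 1 :=
      (V.valuation_le_one_iff _).2 (hRV ⟨c⁻¹, rfl⟩)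
    apply le_antisymm h1
    have h3 : V.valuation (algebraMap k K c) * V.valuation (algebraMap k K c⁻¹) = 1 := by
      rw [← map_mul, ← map_mul, mul_inv_cancel₀ hc, map_one, map_one]
    calc 1 = _ := h3.symm
      _ ≤ V.valuation (algebraMap k K c) * 1 := mul_le_mul_right h2 _
      _ = _ := mul_one _
  · exact not_le.1 (fun h => hxV ((V.valuation_le_one_iff _).1 h))

/-- geometric sum -/
def gs (q j : ℕ) : ℕ := ∑ i ∈ Finset.range j, q ^ i

lemma gs_succ (q j : ℕ) : gs q (j + 1) = gs q j + q ^ j := by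
  simp [gs, Finset.sum_range_succ]

lemma gs_succ' (q j : ℕ) : gs q (j + 1) = q * gs q j + 1 := by
  simp [gs, Finset.sum_range_succ', Finset.mul_sum, pow_succ, mul_comm]

/-- weights -/
def Wt (q : ℕ) : ℕ → (ℕ → ℕ) → ℕ
  | 0, e => e 0
  | m + 1, e => q * Wt q m e + e (m + 1) * gs q (m + 1)

/-- reduced exponents -/
def Red (q m : ℕ) (e : ℕ → ℕ) : Prop := (∀ j, e (j + 1) < q) ∧ ∀ j, m < j → e j = 0

lemma Wt_mod (q m : ℕ) (e : ℕ → ℕ) (he : e (m + 1) < q) : Wt q (m + 1) e % q = e (m + 1) := by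
  have : Wt q (m + 1) e = e (m + 1) + q * (Wt q m e + e (m + 1) * gs q m) := by
    rw [Wt, gs_succ']; ring
  rw [this, Nat.add_mul_mod_self_left, Nat.mod_eq_of_lt he]

lemma Wt_inj (q m : ℕ) (hq : 0 < q) (e e' : ℕ → ℕ) (he : ∀ j, e (j + 1) < q)
    (he' : ∀ j, e' (j + 1) < q) (h : Wt q m e = Wt q m e') : ∀ j ≤ m, e j = e' j := by
  induction m with
  | zero => intro j hj; obtain rfl : j = 0 := by omega
            exact h
  | succ m ih =>
    have h1 : e (m + 1) = e' (m + 1) := by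
      rw [← Wt_mod q m e (he m), ← Wt_mod q m e' (he' m), h]
    have h2 : Wt q m e = Wt q m e' := by
      simp only [Wt, h1] at h
      exact Nat.eq_of_mul_eq_mul_left hq (by omega)
    intro j hj
    rcases Nat.lt_or_ge m j with hlt | hge
    · obtain rfl : j = m + 1 := by omega
      exact h1
    · exact ih h2 j hge

lemma Wt_congr (q m : ℕ) (e e' : ℕ → ℕ) (h : ∀ j ≤ m, e j = e' j) : Wt q m e = Wt q m e' := by
  induction m with
  | zero => exact h 0 le_rfl
  | succ m ih => simp only [Wt]; rw [ih (fun j hj => h j (by omega)), h (m + 1) le_rfl]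

lemma Wt_surj (q m : ℕ) (hq : 0 < q) : ∃ c, ∀ n, c ≤ n → ∃ e, Red q m e ∧ Wt q m e = n := by
  induction m with
  | zero =>
    refine ⟨0, fun n _ => ⟨fun j => if j = 0 then n else 0, ⟨fun j => by simp [hq], ?_⟩, by simp [Wt]⟩⟩
    intro j hj; simp; omega
  | succ m ih =>
    obtain ⟨c, hc⟩ := ih
    refine ⟨q * c + q * gs q (m + 1), fun n hn => ?_⟩
    have hr : n % q < q := Nat.mod_lt _ hq
    have hmul : n % q * gs q (m + 1) ≤ q * gs q (m + 1) := Nat.mul_le_mul_right _ hr.le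
    have hdvd : ∃ n', n = q * n' + n % q * gs q (m + 1) := by
      have h0 := Nat.div_add_mod n q
      have h1 : q * (n % q * gs q m) ≤ q * (n / q) := by
        rw [gs_succ'] at hmul hn
        nlinarith
      refine ⟨n / q - n % q * gs q m, ?_⟩
      have h2 : n % q * gs q m ≤ n / q := Nat.le_of_mul_le_mul_left h1 hq
      obtain ⟨b, hb⟩ := Nat.exists_eq_add_of_le h2
      rw [hb, Nat.add_sub_cancel_left, gs_succ']
      rw [hb] at h0
      nlinarith
    obtain ⟨n', hn'⟩ := hdvd
    have hcn : c ≤ n' := by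
      have : q * c ≤ q * n' := by omega
      exact Nat.le_of_mul_le_mul_left this hq
    obtain ⟨e, he, hW⟩ := hc n' hcn
    refine ⟨fun j => if j = m + 1 then n % q else e j, ⟨?_, ?_⟩, ?_⟩
    · intro j
      by_cases h : j + 1 = m + 1
      · simp [h, hr]
      · simp only [h, if_false]; exact he.1 j
    · intro j hj
      show (if j = m + 1 then n % q else e j) = 0
      rw [if_neg (by omega)]; exact he.2 j (by omega)
    · simp only [Wt, if_true]
      rw [Wt_congr q m _ e (fun j hj => by rw [if_neg (by omega)]), hW, ← hn']

/-- monomials -/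
def mon {A : Type} [CommRing A] (m : ℕ) (e : ℕ → ℕ) (x : A) (z : ℕ → A) : A :=
  x ^ e 0 * ∏ j ∈ Finset.range m, z (j + 1) ^ e (j + 1)

lemma mon_succ {A : Type} [CommRing A] (m : ℕ) (e : ℕ → ℕ) (x : A) (z : ℕ → A) :
    mon (m + 1) e x z = mon m e x z * z (m + 1) ^ e (m + 1) := by
  rw [mon, mon, Finset.prod_range_succ, mul_assoc]

/-- defining relations of the tower -/
def Rel (q : ℕ) {A : Type} [CommRing A] (x : A) (z : ℕ → A) : Prop :=
  z 0 = 1 ∧ ∀ j, z (j + 1) ^ q = z (j + 1) - x * z j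

lemma mon_update_x {A : Type} [CommRing A] (m : ℕ) (e : ℕ → ℕ) (x : A) (z : ℕ → A) :
    x * mon m e x z = mon m (Function.update e 0 (e 0 + 1)) x z := by
  simp only [mon, Function.update_self, pow_succ]
  rw [Finset.prod_congr rfl (g := fun j => z (j + 1) ^ (Function.update e 0 (e 0 + 1)) (j + 1))
    (fun j _ => by rw [Function.update_of_ne (by omega)])]
  ring

lemma mon_update_z {A : Type} [CommRing A] (m : ℕ) (e : ℕ → ℕ) (x : A) (z : ℕ → A) (j n : ℕ)
    (hj : j < m) : z (j + 1) ^ n * mon m e x z = mon m (Function.update e (j + 1) (e (j + 1) + n)) x z := by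
  simp only [mon]
  rw [← Finset.mul_prod_erase _ _ (Finset.mem_range.2 hj),
    ← Finset.mul_prod_erase _ (fun i => z (i + 1) ^ (Function.update e (j + 1) (e (j + 1) + n)) (i + 1))
      (Finset.mem_range.2 hj)]
  rw [Finset.prod_congr rfl (g := fun i => z (i + 1) ^ (Function.update e (j + 1) (e (j + 1) + n)) (i + 1))
    (fun i hi => by rw [Function.update_of_ne (by have := (Finset.mem_erase.1 hi).1; omega)])]
  rw [Function.update_self, Function.update_of_ne (by omega), pow_add]
  ring

section closure
variable {k : Type} [Field k] {A : Type} [CommRing A] [Algebra k A]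

/-- span of reduced monomials -/
def Msub (k : Type) [Field k] {A : Type} [CommRing A] [Algebra k A] (q m : ℕ) (x : A) (z : ℕ → A) :
    Submodule k A := Submodule.span k ((fun e => mon m e x z) '' {e | Red q m e})

lemma mul_closed (q m : ℕ) (x : A) (z : ℕ → A) (w : A)
    (h : ∀ e, Red q m e → w * mon m e x z ∈ Msub k q m x z) (f : A) (hf : f ∈ Msub k q m x z) :
    w * f ∈ Msub k q m x z := by
  induction hf using Submodule.span_induction with
  | mem y hy => obtain ⟨e, he, rfl⟩ := hy; exact h e he
  | zero => simp
  | add a b _ _ ha hb => rw [mul_add]; exact Submodule.add_mem _ ha hb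
  | smul c a _ ha => rw [mul_smul_comm]; exact Submodule.smul_mem _ _ ha

lemma x_closed (q m : ℕ) (x : A) (z : ℕ → A) (f : A) (hf : f ∈ Msub k q m x z) :
    x * f ∈ Msub k q m x z := by
  refine mul_closed q m x z x (fun e he => ?_) f hf
  rw [mon_update_x]
  refine Submodule.subset_span ⟨_, ⟨fun j => ?_, fun j hj => ?_⟩, rfl⟩
  · rw [Function.update_of_ne (by omega)]; exact he.1 j
  · rw [Function.update_of_ne (by omega)]; exact he.2 j hj

lemma z_closed (q m : ℕ) (hq : 2 ≤ q) (x : A) (z : ℕ → A) (hR : Rel q x z) (j : ℕ) (hj : j ≤ m) :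
    ∀ f ∈ Msub k q m x z, z j * f ∈ Msub k q m x z := by
  induction j with
  | zero => intro f hf; rw [hR.1, one_mul]; exact hf
  | succ j ih =>
    refine mul_closed q m x z _ (fun e he => ?_)
    have hupd : ∀ n, n < q → Red q m (Function.update e (j + 1) n) := by
      intro n hn
      refine ⟨fun i => ?_, fun i hi => ?_⟩
      · by_cases h : i = j
        · subst h; simpa using hn
        · rw [Function.update_of_ne (by omega)]; exact he.1 i
      · rw [Function.update_of_ne (by omega)]; exact he.2 i hi
    by_cases hlt : e (j + 1) + 1 < q
    · have := mon_update_z m e x z j 1 (by omega)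
      rw [pow_one] at this
      rw [this]
      exact Submodule.subset_span ⟨_, hupd _ hlt, rfl⟩
    · have heq : e (j + 1) + 1 = q := by have := he.1 j; omega
      set e' := Function.update e (j + 1) 0 with he'
      have h1 := mon_update_z m e' x z j (e (j + 1)) (by omega)
      have h2 : Function.update e' (j + 1) (e' (j + 1) + e (j + 1)) = e := by
        simp [he']
      rw [h2] at h1
      have h3 := mon_update_z m e' x z j 1 (by omega)
      rw [← h1, ← mul_assoc, ← pow_succ', heq, hR.2 j, sub_mul]
      have hM : mon m e' x z ∈ Msub k q m x z :=
        Submodule.subset_span ⟨_, hupd 0 (by omega), rfl⟩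
      apply Submodule.sub_mem
      · rw [pow_one] at h3
        rw [h3]
        refine Submodule.subset_span ⟨_, ?_, rfl⟩
        have : Function.update e' (j + 1) (e' (j + 1) + 1) = Function.update e (j + 1) 1 := by
          simp [he']
        rw [this]
        exact hupd 1 (by omega)
      · rw [mul_assoc]
        exact x_closed q m x z _ (ih (by omega) _ hM)

/-- the coordinate ring as a subalgebra -/
def OO (k : Type) [Field k] {A : Type} [CommRing A] [Algebra k A] (q m : ℕ) (hq : 2 ≤ q) (x : A)
    (z : ℕ → A) (hR : Rel q x z) : Subalgebra k A :=
  (Msub k q m x z).toSubalgebra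
    (Submodule.subset_span ⟨fun _ => 0, ⟨fun _ => by show 0 < q; omega, fun _ _ => rfl⟩, by simp [mon]⟩)
    (by
      intro a b ha hb
      refine (mul_comm a b) ▸ mul_closed q m x z b (fun e he => ?_) a ha
      rw [mul_comm]
      unfold mon
      rw [mul_assoc]
      have hprod : ∀ n ≤ m, (∏ j ∈ Finset.range n, z (j + 1) ^ e (j + 1)) * b ∈ Msub k q m x z := by
        intro n hn
        induction n with
        | zero => simpa using hb
        | succ n ih =>
          rw [Finset.prod_range_succ, mul_comm (∏ j ∈ Finset.range n, z (j + 1) ^ e (j + 1)), mul_assoc]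
          have := ih (by omega)
          generalize e (n + 1) = N
          induction N with
          | zero => simpa using this
          | succ N ih' => rw [pow_succ', mul_assoc]; exact z_closed q m hq x z hR _ hn _ ih'
      have := hprod m le_rfl
      generalize e 0 = N
      induction N with
      | zero => simpa using this
      | succ N ih' => rw [pow_succ', mul_assoc]; exact x_closed q m x z _ ih')

lemma x_mem (q m : ℕ) (hq : 2 ≤ q) (x : A) (z : ℕ → A) (hR : Rel q x z) :
    x ∈ OO k q m hq x z hR := by
  have := x_closed (k := k) q m x z 1 (OO k q m hq x z hR).one_mem
  rwa [mul_one] at this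

lemma z_mem (q m : ℕ) (hq : 2 ≤ q) (x : A) (z : ℕ → A) (hR : Rel q x z) (j : ℕ) (hj : j ≤ m) :
    z j ∈ OO k q m hq x z hR := by
  have := z_closed (k := k) q m hq x z hR j hj 1 (OO k q m hq x z hR).one_mem
  rwa [mul_one] at this

lemma mon_mem (B : Subalgebra k A) (m : ℕ) (e : ℕ → ℕ) (x : A) (z : ℕ → A) (hx : x ∈ B)
    (hz : ∀ j ≤ m, z j ∈ B) : mon m e x z ∈ B := by
  apply B.mul_mem (B.pow_mem hx _)
  apply B.prod_mem
  intro j hj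
  exact B.pow_mem (hz _ (by have := Finset.mem_range.1 hj; omega)) _

end closure

section values
variable {K : Type} [CommRing K] {Γ : Type} [LinearOrderedCommGroupWithZero Γ] (v : Valuation K Γ)

lemma val_z (q : ℕ) (hq : 2 ≤ q) (x : K) (z : ℕ → K) (hR : Rel q x z) (hx : 1 < v x) (j : ℕ) :
    1 ≤ v (z j) ∧ v (z j) ^ q ^ j = v x ^ gs q j := by
  induction j with
  | zero => simp [hR.1, gs]
  | succ j ih =>
    have h1 : 1 < v (x * z j) := by
      rw [map_mul]; exact one_lt_mul_of_lt_of_le hx ih.1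
    have h2 : z (j + 1) - z (j + 1) ^ q = x * z j := by rw [hR.2 j]; ring
    have h3 : 1 < v (z (j + 1)) := by
      by_contra hle
      push Not at hle
      rw [← h2] at h1
      have h4 := v.map_sub (z (j + 1)) (z (j + 1) ^ q)
      have h5 : v (z (j + 1) ^ q) ≤ 1 := by rw [map_pow]; exact pow_le_one' hle _
      exact absurd h1 (not_lt.2 (h4.trans (max_le hle h5)))
    refine ⟨h3.le, ?_⟩
    have h4 : v (z (j + 1)) ^ q = v x * v (z j) := by
      rw [← map_mul, ← h2, ← map_pow]
      refine (v.map_sub_eq_of_lt_right ?_).symm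
      rw [map_pow]
      calc v (z (j + 1)) = v (z (j + 1)) ^ 1 := (pow_one _).symm
        _ < _ := pow_lt_pow_right₀ h3 (by omega)
    rw [pow_succ', pow_mul, h4, mul_pow, ih.2, ← pow_add, gs_succ, add_comm]

lemma val_z_lt (q : ℕ) (hq : 2 ≤ q) (x : K) (z : ℕ → K) (hR : Rel q x z) (hx : 1 < v x) (j : ℕ) :
    v (z j) < v (z (j + 1)) := by
  have h1 := (val_z v q hq x z hR hx j).2
  have h2 := (val_z v q hq x z hR hx (j + 1)).2
  apply lt_of_pow_lt_pow_left₀ (q ^ (j + 1)) zero_le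
  rw [h2, pow_succ, pow_mul, h1, ← pow_mul]
  apply pow_lt_pow_right₀ hx
  rw [gs_succ', mul_comm]; omega

lemma val_z_mono (q : ℕ) (hq : 2 ≤ q) (x : K) (z : ℕ → K) (hR : Rel q x z) (hx : 1 < v x) :
    StrictMono (fun j => v (z j)) := strictMono_nat_of_lt_succ (val_z_lt v q hq x z hR hx)

lemma val_mon (q m : ℕ) (e : ℕ → ℕ) (γ : Γ) (x : K) (z : ℕ → K) (hx : v x = γ)
    (hz : ∀ j ≤ m, v (z j) ^ q ^ j = γ ^ gs q j) : v (mon m e x z) ^ q ^ m = γ ^ Wt q m e := by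
  induction m with
  | zero => simp [mon, Wt, hx]
  | succ m ih =>
    have h1 : v (mon m e x z) ^ q ^ (m + 1) = (γ ^ Wt q m e) ^ q := by
      rw [pow_succ, pow_mul, ih (fun j hj => hz j (by omega))]
    rw [mon_succ, map_mul, mul_pow, h1, map_pow, ← pow_mul (v (z (m + 1))), mul_comm (e (m + 1)),
      pow_mul (v (z (m + 1))), hz _ le_rfl, ← pow_mul, ← pow_mul, ← pow_add, Wt]
    congr 1
    ring

end values
end LV

open Polynomial Finset Filter
open scoped Classical
namespace LV

lemma sep_top {k : Type} [Field k] {ι : Type} [Fintype ι] (B : Subalgebra k (ι → k))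
    (hsep : ∀ i j, i ≠ j → ∃ f ∈ B, f i ≠ f j) (g : ι → k) : g ∈ B := by
  have h1 : ∀ i j, ∃ f ∈ B, i ≠ j → f i = 1 ∧ f j = 0 := by
    intro i j
    by_cases hij : i = j
    · exact ⟨0, B.zero_mem, fun h => absurd hij h⟩
    · obtain ⟨f, hf, hne⟩ := hsep i j hij
      refine ⟨(f i - f j)⁻¹ • (f - algebraMap k _ (f j)),
        B.smul_mem (B.sub_mem hf (B.algebraMap_mem _)) _, fun _ => ⟨?_, ?_⟩⟩
      · simp [inv_mul_cancel₀ (sub_ne_zero.2 hne)]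
      · simp
  choose f hf hf' using h1
  have h2 : g = ∑ i, g i • ∏ j ∈ univ.erase i, f i j := by
    funext l
    rw [Finset.sum_apply, Finset.sum_eq_single l]
    · rw [Pi.smul_apply, Finset.prod_apply, Finset.prod_eq_one, smul_eq_mul, mul_one]
      intro j hj
      exact (hf' l j (Finset.mem_erase.1 hj).1.symm).1
    · intro i _ hi
      have h3 : ∏ c ∈ univ.erase i, f i c l = 0 :=
        Finset.prod_eq_zero (i := l) (Finset.mem_erase.2 ⟨hi.symm, Finset.mem_univ _⟩) (hf' i l hi).2
      rw [Pi.smul_apply, Finset.prod_apply, h3, smul_zero]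
    · simp
  rw [h2]
  exact B.sum_mem (fun i _ => B.smul_mem (B.prod_mem (fun j _ => hf i j)) _)

lemma exists_as (K : Type) [Field K] [IsAlgClosed K] (q : ℕ) (hq : 2 ≤ q) (w : K) :
    ∃ r : K, r ^ q = r - w := by
  have hd : (X ^ q - (X - C w) : K[X]).natDegree = q := by
    rw [natDegree_sub_eq_left_of_natDegree_lt]
    · simp
    · rw [natDegree_X_sub_C, natDegree_X_pow]; omega
  obtain ⟨r, hr⟩ := IsAlgClosed.exists_root (X ^ q - (X - C w) : K[X])
    (by intro h; have h' := natDegree_eq_of_degree_eq_some h; rw [hd] at h'; exact absurd h' (by show q ≠ 0; omega))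
  refine ⟨r, ?_⟩
  simp only [IsRoot.def, eval_sub, eval_pow, eval_X, eval_C] at hr
  exact sub_eq_zero.1 hr

lemma exists_tower (K : Type) [Field K] [IsAlgClosed K] (q : ℕ) (hq : 2 ≤ q) (x : K) :
    ∃ z : ℕ → K, Rel q x z := by
  choose ρ hρ using exists_as K q hq
  exact ⟨fun n => Nat.rec 1 (fun _ w => ρ (x * w)) n, rfl, fun j => hρ _⟩

lemma mon_map {A B : Type} [CommRing A] [CommRing B] (φ : A →+* B) (m : ℕ) (e : ℕ → ℕ) (x : A)
    (z : ℕ → A) : φ (mon m e x z) = mon m e (φ x) (fun j => φ (z j)) := by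
  simp [mon, map_prod]

lemma mon_congr {A : Type} [CommRing A] (m : ℕ) (e : ℕ → ℕ) (x : A) (z z' : ℕ → A)
    (h : ∀ j ≤ m, z j = z' j) : mon m e x z = mon m e x z' := by
  unfold mon
  congr 1
  exact Finset.prod_congr rfl (fun j hj => by rw [h _ (by have := Finset.mem_range.1 hj; omega)])

lemma mon_pow {A : Type} [CommRing A] (m : ℕ) (e : ℕ → ℕ) (x : A) (z : ℕ → A) (n : ℕ) :
    mon m e x z ^ n = mon m e (x ^ n) (fun j => z j ^ n) := by
  simp only [mon, mul_pow, ← Finset.prod_pow, ← pow_mul, mul_comm n]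

lemma val_twist {K : Type} [CommRing K] {Γ : Type} [LinearOrderedCommGroupWithZero Γ]
    (v : Valuation K Γ) (z : ℕ → K) (hm : StrictMono (fun j => v (z j))) (u : ℕ → K) (hu0 : u 0 = 1)
    (hu : ∀ j, v (u j) ≤ 1) (h0 : 1 ≤ v (z 0)) (j : ℕ) :
    v (∑ a ∈ Finset.range (j + 1), u a * z (j - a)) = v (z j) := by
  rw [Finset.sum_range_succ', hu0, one_mul, Nat.sub_zero]
  apply v.map_add_eq_of_lt_right
  apply v.map_sum_lt
  · have h1 : v (z 0) ≤ v (z j) := hm.monotone (Nat.zero_le j)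
    exact (zero_lt_one.trans_le (h0.trans h1)).ne'
  · intro a ha
    have h2 : v (z (j - (a + 1))) < v (z j) := hm (by have := Finset.mem_range.1 ha; omega)
    rw [map_mul]
    calc _ ≤ 1 * v (z (j - (a + 1))) := mul_le_mul_left (hu _) _
      _ < _ := by rwa [one_mul]

/-- the set of pole orders -/
def SS (q m : ℕ) : Set ℕ := {s | ∃ e, Red q m e ∧ Wt q m e = s}

theorem curve_bound (F : Type) [Field F] [Fintype F] (k : Type) [Field k] [Algebra F k]
    [IsAlgClosed k] (m : ℕ) :
    ∃ C P0 : ℕ, ∀ y P : ℕ, P = Fintype.card F ^ y → P0 ≤ P →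
      ∀ (ι : Type) [Fintype ι] (px : ι → k) (pz : ι → ℕ → k) (u : ℕ → F),
      (∀ i, Rel (Fintype.card F) (px i) (pz i)) →
      (∀ i j, px i = px j → (∀ n ≤ m, pz i n = pz j n) → i = j) →
      u 0 = 1 → (∀ i, px i ^ (P * P) = px i) →
      (∀ i, ∀ j ≤ m, (∑ a ∈ Finset.range (j + 1), algebraMap F k (u a) * pz i (j - a)) ^ (P * P)
        = pz i j) →
      Fintype.card ι ≤ P * P + C * P := by
  set q := Fintype.card F with hqdef
  have hq : 2 ≤ q := Fintype.one_lt_card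
  obtain ⟨c0, hc0⟩ := Wt_surj q m (by omega)
  set S := SS q m with hS
  set g := ((Finset.range c0).filter (· ∉ S)).card with hg
  refine ⟨2 * g + 1, c0 + 1 + (g + 1) ^ 2 + 1, ?_⟩
  intro y P hP hP0 ι _ px pz u hR hinj hu0 hpx hpz
  obtain ⟨K, _, _, _, Γ, _, v, x, hvk, hvx⟩ := exists_val k
  obtain ⟨zK, hzK⟩ := exists_tower K q hq x
  let xA : K × (ι → k) := (x, px)
  let zA : ℕ → K × (ι → k) := fun j => (zK j, fun i => pz i j)
  have hRA : Rel q xA zA := by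
    refine ⟨Prod.ext hzK.1 (funext fun i => (hR i).1), fun j => ?_⟩
    refine Prod.ext ?_ (funext fun i => ?_)
    · exact hzK.2 j
    · exact (hR i).2 j
  let O := OO k q m hq xA zA hRA
  have hqm : q ^ m ≠ 0 := by positivity
  let φ : O →+* K := (RingHom.fst K (ι → k)).comp O.val.toRingHom
  let w : Valuation O Γ := (v.comap φ).map (powMonoidWithZeroHom hqm)
    (fun a b hab => pow_le_pow_left' hab _)
  have hw : ∀ f : O, w f = v f.1.1 ^ q ^ m := fun f => rfl
  let xO : O := ⟨xA, x_mem q m hq xA zA hRA⟩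
  let zO : ℕ → O := fun j => if hj : j ≤ m then ⟨zA j, z_mem q m hq xA zA hRA j hj⟩ else 0
  have hzO : ∀ j ≤ m, (zO j).1 = zA j := by
    intro j hj; simp only [zO, dif_pos hj]
  have hsel : ∀ s, ∃ e, s ∈ S → Red q m e ∧ Wt q m e = s := by
    intro s
    by_cases hs : s ∈ S
    · obtain ⟨e, he⟩ := hs; exact ⟨e, fun _ => he⟩
    · exact ⟨fun _ => 0, fun h => absurd h hs⟩
  choose E hE using hsel
  let t : ℕ → O := fun s => mon m (E s) xO zO
  let zO' : ℕ → O := fun j => ∑ a ∈ Finset.range (j + 1),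
    algebraMap k O (algebraMap F k (u a)) * zO (j - a)
  let τ : ℕ → O := fun s => mon m (E s) xO zO'
  have hval : ∀ j, v (zK j) ^ q ^ j = v x ^ gs q j := fun j => (val_z v q hq x zK hzK hvx j).2
  have hvz : ∀ s ∈ S, w (t s) = v x ^ s := by
    intro s hs
    rw [hw]
    have h1 : ((t s).1).1 = φ (t s) := rfl
    rw [h1, mon_map, val_mon v q m (E s) (v x) (φ xO) _ rfl, (hE s hs).2]
    intro j hj
    have h2 : φ (zO j) = zK j := by
      show ((zO j).1).1 = _
      rw [hzO j hj]
    rw [h2]; exact hval j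
  have hvk1 : ∀ c : k, v (algebraMap k K c) ≤ 1 := by
    intro c
    by_cases h : c = 0
    · simp [h]
    · exact (hvk c h).le
  have hvτ : ∀ s ∈ S, w (τ s) = v x ^ s := by
    intro s hs
    rw [hw]
    have h1 : ((τ s).1).1 = φ (τ s) := rfl
    rw [h1, mon_map, val_mon v q m (E s) (v x) (φ xO) _ rfl, (hE s hs).2]
    intro j hj
    have h2 : φ (zO' j) = ∑ a ∈ Finset.range (j + 1), algebraMap k K (algebraMap F k (u a)) * zK (j - a) := by
      rw [map_sum]
      refine Finset.sum_congr rfl (fun a ha => ?_)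
      rw [map_mul]
      congr 1
      show ((zO (j - a)).1).1 = _
      rw [hzO _ (by omega)]
    rw [h2, val_twist v zK (val_z_mono v q hq x zK hzK hvx) (fun a => algebraMap k K (algebraMap F k (u a)))
      (by simp [hu0]) (fun j => hvk1 _) (by simp [hzK.1])]
    exact hval j
  have D : Data w (v x) S t k := by
    refine ⟨hvx, ?_, hvz, ?_⟩
    · intro c hc
      rw [hw]
      show v (algebraMap k K c) ^ _ = 1
      rw [hvk c hc, one_pow]
    · intro f
      have hf : f.1 ∈ Msub k q m xA zA := f.2
      have h1 : (fun e => mon m e xA zA) '' {e | Red q m e} ⊆ O.val.toLinearMap '' (t '' S) := by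
        rintro _ ⟨e, he, rfl⟩
        refine ⟨t (Wt q m e), ⟨Wt q m e, ⟨e, he, rfl⟩, rfl⟩, ?_⟩
        have hEe := hE (Wt q m e) ⟨e, he, rfl⟩
        have h2 := Wt_inj q m (by omega) _ _ hEe.1.1 he.1 hEe.2
        have h3 : E (Wt q m e) = e := by
          funext j
          rcases Nat.lt_or_ge m j with h | h
          · rw [hEe.1.2 j h, he.2 j h]
          · exact h2 j h
        show O.val.toRingHom (mon m (E (Wt q m e)) xO zO) = _
        rw [h3, mon_map]
        exact mon_congr m e xA _ _ hzO
      have h2 : f.1 ∈ (Submodule.span k (t '' S)).map O.val.toLinearMap := by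
        rw [Submodule.map_span]
        exact Submodule.span_mono h1 hf
      obtain ⟨f', hf', h3⟩ := h2
      have h4 : f' = f := Subtype.ext h3
      rwa [← h4]
  let ev : O →ₐ[k] (ι → k) := (AlgHom.snd k K (ι → k)).comp O.val
  have hevx : ev xO = px := rfl
  have hevz : ∀ j ≤ m, ev (zO j) = fun i => pz i j := by
    intro j hj
    show ((zO j).1).2 = _
    rw [hzO j hj]
  have hev : Function.Surjective ev := by
    intro f
    have := sep_top ev.range (fun i j hij => ?_) f
    · exact this
    · by_contra hcon
      push Not at hcon
      apply hij
      apply hinj i j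
      · have := hcon (ev xO) ⟨_, rfl⟩
        exact this
      · intro n hn
        have := hcon (ev (zO n)) ⟨_, rfl⟩
        rw [hevz n hn] at this
        exact this
  obtain ⟨p, n, hp, hpn, hcard⟩ : ∃ p n : ℕ, p.Prime ∧ CharP F p ∧ q = p ^ n := by
    obtain ⟨p, hc⟩ := CharP.exists F
    obtain ⟨n, hp, hn⟩ := FiniteField.card F p
    exact ⟨p, n, hp, hc, hn⟩
  have : CharP k p := charP_of_injective_algebraMap (algebraMap F k).injective p
  have : ExpChar k p := ExpChar.prime hp
  refine D.stepanov p ev hev τ hvτ (n * y) P (by rw [hP, hcard, pow_mul]) ?_ c0 g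
    (fun n hn => hc0 n hn) hg (by have := Nat.zero_le ((g+1)^2); omega) (by omega)
  intro s hs i
  let ψ : O →+* k := (Pi.evalRingHom (fun _ : ι => k) i).comp ev.toRingHom
  show ψ (τ s) ^ (P * P) = ψ (t s)
  rw [mon_map, mon_map, mon_pow]
  have hx1 : ψ xO ^ (P * P) = ψ xO := hpx i
  rw [hx1]
  refine mon_congr m _ _ _ _ (fun j hj => ?_)
  have h1 : ψ (zO j) = pz i j := by
    show ev (zO j) i = _
    rw [hevz j hj]
  have h2 : ψ (zO' j) = ∑ a ∈ Finset.range (j + 1), algebraMap F k (u a) * pz i (j - a) := by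
    rw [map_sum]
    refine Finset.sum_congr rfl (fun a ha => ?_)
    rw [map_mul]
    have h3 : ψ (zO (j - a)) = pz i (j - a) := by
      show ev (zO (j - a)) i = _
      rw [hevz _ (by omega)]
    rw [h3]
    rfl
  rw [h1, h2, hpz i j hj]

end LV

open Polynomial Finset Filter
open scoped Classical
set_option linter.unusedSectionVars false
namespace LV

section basics
variable {F : Type} [Field F] [Fintype F]

lemma sum_coeff (n : ℕ) (c : Fin n → F) (j : ℕ) :
    (∑ i : Fin n, C (c i) * X ^ (i : ℕ) : F[X]).coeff j = if h : j < n then c ⟨j, h⟩ else 0 := by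
  simp only [finsetSum_coeff, coeff_C_mul, coeff_X_pow]
  split_ifs with h
  · rw [Finset.sum_eq_single ⟨j, h⟩]
    · simp
    · intro b _ hb
      have : j ≠ b := fun h' => hb (Fin.ext h'.symm)
      simp [this]
    · simp
  · apply Finset.sum_eq_zero
    intro b _
    have : j ≠ b := by have := b.2; omega
    simp [this]

lemma sum_degree_lt (n : ℕ) (c : Fin n → F) :
    (∑ i : Fin n, C (c i) * X ^ (i : ℕ) : F[X]).degree < n := by
  rw [Polynomial.degree_lt_iff_coeff_zero]
  intro j hj
  rw [sum_coeff, dif_neg (by omega)]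

lemma mem_Mn {n : ℕ} {f : F[X]} : f ∈ Mn F n ↔ f.Monic ∧ f.natDegree = n := by
  simp only [Mn, Finset.mem_image, Finset.mem_univ, true_and]
  constructor
  · rintro ⟨c, rfl⟩
    exact ⟨monic_X_pow_add (sum_degree_lt n c),
      natDegree_eq_of_degree_eq_some (by
        rw [degree_add_eq_left_of_degree_lt (by rw [degree_X_pow]; exact sum_degree_lt n c),
          degree_X_pow])⟩
  · rintro ⟨hm, hd⟩
    refine ⟨fun i => f.coeff i, ?_⟩
    conv_rhs => rw [hm.as_sum, hd]
    rw [Fin.sum_univ_eq_sum_range (fun i => C (f.coeff i) * X ^ i) n]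

lemma card_Mn (n : ℕ) : (Mn F n).card = Fintype.card F ^ n := by
  rw [Mn, Finset.card_image_of_injective]
  · simp
  · intro c c' h
    have h' := add_left_cancel h
    funext i
    have := congrArg (fun p => coeff p i) h'
    simp only [sum_coeff] at this
    simpa using this

lemma Mn_zero : Mn F 0 = {1} := by
  ext f
  rw [mem_Mn, Finset.mem_singleton]
  constructor
  · rintro ⟨hm, hd⟩; exact hm.natDegree_eq_zero.1 hd
  · rintro rfl; simp

lemma mem_Px {n : ℕ} {f : F[X]} : f ∈ Px F n ↔ f.Monic ∧ f.natDegree = n ∧ Irreducible f := by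
  rw [Px, Finset.mem_filter, mem_Mn, and_assoc]

lemma mem_Dle {h : ℕ} {f : F[X]} : f ∈ Dle F h ↔ f.degree < (h + 1 : ℕ) := by
  simp only [Dle, Finset.mem_image, Finset.mem_univ, true_and]
  constructor
  · rintro ⟨c, rfl⟩; exact sum_degree_lt (h + 1) c
  · intro hd
    refine ⟨fun i => f.coeff i, ?_⟩
    ext j
    rw [sum_coeff]
    split_ifs with hj
    · rfl
    · rw [(Polynomial.degree_lt_iff_coeff_zero f (h + 1)).1 hd j (by omega)]

lemma card_Dle (h : ℕ) : (Dle F h).card = Fintype.card F ^ (h + 1) := by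
  rw [Dle, Finset.card_image_of_injective]
  · simp
  · intro c c' h
    funext i
    have := congrArg (fun p => coeff p i) h
    simp only [sum_coeff, i.2, dif_pos] at this
    exact this

end basics

section units
variable (F : Type) [Field F] [Fintype F] (m : ℕ)

/-- truncated polynomial ring -/
abbrev TR : Type := F[X] ⧸ Ideal.span {(X ^ (m + 1) : F[X])}

lemma TR_eq (f g : F[X]) : (Ideal.Quotient.mk (Ideal.span {(X ^ (m + 1) : F[X])}) f =
    Ideal.Quotient.mk _ g) ↔ ∀ i ≤ m, f.coeff i = g.coeff i := by
  rw [Ideal.Quotient.eq, Ideal.mem_span_singleton, Polynomial.X_pow_dvd_iff]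
  simp only [coeff_sub, sub_eq_zero, Nat.lt_succ_iff]

/-- constant term -/
noncomputable def cst : TR F m →+* F :=
  Ideal.Quotient.lift _ (constantCoeff : F[X] →+* F) (by
    intro a ha
    rw [Ideal.mem_span_singleton, Polynomial.X_pow_dvd_iff] at ha
    exact ha 0 (by omega))

/-- one-units -/
abbrev UU : Type := (Units.map (cst F m).toMonoidHom).ker

noncomputable instance : Finite (TR F m) := by
  have : Function.Surjective (fun c : Fin (m + 1) → F =>
      Ideal.Quotient.mk (Ideal.span {(X ^ (m + 1) : F[X])}) (∑ i : Fin (m + 1), C (c i) * X ^ (i : ℕ))) := by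
    intro a
    obtain ⟨p, rfl⟩ := Ideal.Quotient.mk_surjective a
    refine ⟨fun i => p.coeff i, ?_⟩
    rw [TR_eq]
    intro i hi
    rw [sum_coeff, dif_pos (by omega)]
  exact Finite.of_surjective _ this

noncomputable instance : Fintype (UU F m) := Fintype.ofFinite _

variable {F}

lemma unit_of_one (p : F[X]) (hp : p.coeff 0 = 1) :
    IsUnit (Ideal.Quotient.mk (Ideal.span {(X ^ (m + 1) : F[X])}) p) := by
  have h1 : IsCoprime p (X ^ (m + 1)) := by
    apply IsCoprime.pow_right
    obtain ⟨g, hg⟩ : X ∣ p - 1 := by rw [X_dvd_iff]; simp [hp]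
    exact ⟨1, -g, by linear_combination hg⟩
  obtain ⟨a, b, hab⟩ := h1
  apply IsUnit.of_mul_eq_one (Ideal.Quotient.mk _ a)
  rw [← map_mul, ← map_one (Ideal.Quotient.mk _), Ideal.Quotient.eq, Ideal.mem_span_singleton]
  exact ⟨-b, by linear_combination hab⟩

lemma exists_pi (f : F[X]) : ∃ u : UU F m, f.Monic →
    ((u : (TR F m)ˣ) : TR F m) = Ideal.Quotient.mk _ f.reverse := by
  by_cases hf : f.Monic
  · have h0 : f.reverse.coeff 0 = 1 := by rw [coeff_zero_reverse]; exact hf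
    obtain ⟨w, hw⟩ := unit_of_one m f.reverse h0
    refine ⟨⟨w, ?_⟩, fun _ => hw⟩
    rw [MonoidHom.mem_ker]
    ext
    show cst F m w = 1
    rw [hw]
    exact h0
  · exact ⟨1, fun h => absurd h hf⟩

/-- class of a monic polynomial -/
noncomputable def pi (f : F[X]) : UU F m := (exists_pi m f).choose

lemma pi_spec {f : F[X]} (hf : f.Monic) :
    ((pi m f : (TR F m)ˣ) : TR F m) = Ideal.Quotient.mk _ f.reverse :=
  (exists_pi m f).choose_spec hf

lemma UU_ext {u v : UU F m} (h : ((u : (TR F m)ˣ) : TR F m) = ((v : (TR F m)ˣ) : TR F m)) : u = v :=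
  Subtype.ext (Units.ext h)

lemma pi_mul {f g : F[X]} (hf : f.Monic) (hg : g.Monic) : pi m (f * g) = pi m f * pi m g := by
  apply UU_ext
  rw [pi_spec m (hf.mul hg), reverse_mul_of_domain, map_mul, ← pi_spec m hf, ← pi_spec m hg]
  rfl

lemma pi_one : pi m (1 : F[X]) = 1 := by
  apply UU_ext
  rw [pi_spec m monic_one]
  have h1 : (1 : F[X]).reverse = 1 := by rw [← C_1, reverse_C]
  rw [h1, map_one]
  rfl

lemma pi_eq_iff {f g : F[X]} (hf : f.Monic) (hg : g.Monic) :
    pi m f = pi m g ↔ ∀ i ≤ m, f.reverse.coeff i = g.reverse.coeff i := by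
  rw [← TR_eq, ← pi_spec m hf, ← pi_spec m hg]
  constructor
  · intro h; rw [h]
  · exact UU_ext m

lemma pi_surj (u : UU F m) : ∃ f ∈ Mn F m, pi m f = u := by
  obtain ⟨p, hp⟩ := Ideal.Quotient.mk_surjective (((u : (TR F m)ˣ) : TR F m))
  have hp0 : p.coeff 0 = 1 := by
    have h1 := u.2
    rw [MonoidHom.mem_ker] at h1
    have h2 := congrArg Units.val h1
    have h3 : cst F m ((u : (TR F m)ˣ) : TR F m) = 1 := h2
    rw [← hp] at h3
    exact h3
  let f : F[X] := X ^ m + ∑ i : Fin m, C (p.coeff (m - i)) * X ^ (i : ℕ)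
  have hf : f ∈ Mn F m := Finset.mem_image.2 ⟨fun i => p.coeff (m - i), Finset.mem_univ _, rfl⟩
  have hf' := mem_Mn.1 hf
  refine ⟨f, hf, UU_ext m ?_⟩
  rw [pi_spec m hf'.1, ← hp, TR_eq]
  intro i hi
  rw [coeff_reverse, hf'.2, revAt_le hi]
  simp only [f, coeff_add, sum_coeff, coeff_X_pow]
  by_cases h0 : i = 0
  · subst h0; simp [hp0]
  · rw [if_neg (by omega), dif_pos (by omega), zero_add]
    congr 1
    show m - (m - i) = i
    omega

lemma rev_coeff {n : ℕ} {f : F[X]} (hf : f.natDegree = n) {i : ℕ} (hi : i ≤ n) :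
    f.reverse.coeff i = f.coeff (n - i) := by
  rw [coeff_reverse, hf, revAt_le hi]

/-- for n ≥ m : classes on M_n are intervals -/
lemma pi_eq_iff_of_ge {n : ℕ} (hn : m ≤ n) {f g : F[X]} (hf : f ∈ Mn F n) (hg : g ∈ Mn F n) :
    pi m f = pi m g ↔ (f - g).degree < (n - m : ℕ) := by
  rw [mem_Mn] at hf hg
  rw [pi_eq_iff m hf.1 hg.1, Polynomial.degree_lt_iff_coeff_zero]
  constructor
  · intro h j hj
    rw [coeff_sub, sub_eq_zero]
    rcases Nat.lt_or_ge n j with hlt | hge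
    · rw [coeff_eq_zero_of_natDegree_lt (by omega), coeff_eq_zero_of_natDegree_lt (by omega)]
    · have := h (n - j) (by omega)
      rw [rev_coeff hf.2 (by omega), rev_coeff hg.2 (by omega), Nat.sub_sub_self hge] at this
      exact this
  · intro h i hi
    rw [rev_coeff hf.2 (by omega), rev_coeff hg.2 (by omega)]
    have := h (n - i) (by omega)
    rwa [coeff_sub, sub_eq_zero] at this

lemma pi_inj_of_le {n : ℕ} (hn : n ≤ m) {f g : F[X]} (hf : f ∈ Mn F n) (hg : g ∈ Mn F n)
    (h : pi m f = pi m g) : f = g := by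
  rw [mem_Mn] at hf hg
  rw [pi_eq_iff m hf.1 hg.1] at h
  ext j
  rcases Nat.lt_or_ge n j with hlt | hge
  · rw [coeff_eq_zero_of_natDegree_lt (by omega), coeff_eq_zero_of_natDegree_lt (by omega)]
  · have := h (n - j) (by omega)
    rw [rev_coeff hf.2 (by omega), rev_coeff hg.2 (by omega), Nat.sub_sub_self hge] at this
    exact this

/-- a section on M_n, n ≥ m -/
lemma exists_rep {n : ℕ} (hn : m ≤ n) (u : UU F m) : ∃ f ∈ Mn F n, pi m f = u := by
  obtain ⟨f, hf, rfl⟩ := pi_surj m u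
  have hf' := mem_Mn.1 hf
  have hX : (X ^ (n - m) : F[X]).Monic := monic_X_pow _
  have hmem : X ^ (n - m) * f ∈ Mn F n := by
    rw [mem_Mn]
    refine ⟨hX.mul hf'.1, ?_⟩
    rw [hX.natDegree_mul hf'.1, natDegree_X_pow, hf'.2]; omega
  refine ⟨_, hmem, ?_⟩
  rw [pi_eq_iff m (mem_Mn.1 hmem).1 hf'.1]
  intro i hi
  rw [rev_coeff (mem_Mn.1 hmem).2 (by omega), rev_coeff hf'.2 hi, coeff_X_pow_mul',
    if_pos (by omega)]
  congr 1; omega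

lemma fiber_eq {n h : ℕ} (hn : n = m + (h + 1)) {g : F[X]} (hg : g ∈ Mn F n) :
    (Mn F n).filter (fun f => pi m f = pi m g) = Ih h g := by
  ext f
  rw [Finset.mem_filter, Ih, Finset.mem_image]
  constructor
  · rintro ⟨hf, h1⟩
    rw [pi_eq_iff_of_ge m (by omega) hf hg] at h1
    exact ⟨f - g, mem_Dle.2 (by rw [show n - m = h + 1 by omega] at h1; exact h1), by ring⟩
  · rintro ⟨E, hE, rfl⟩
    rw [mem_Dle] at hE
    have hg' := mem_Mn.1 hg
    have hlt : E.degree < g.degree := by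
      rw [degree_eq_natDegree hg'.1.ne_zero, hg'.2]
      refine hE.trans_le ?_
      exact_mod_cast (by omega : h + 1 ≤ n)
    have hmem : g + E ∈ Mn F n := by
      rw [mem_Mn]
      refine ⟨hg'.1.add_of_left hlt, ?_⟩
      rw [natDegree_add_eq_left_of_degree_lt hlt, hg'.2]
    refine ⟨hmem, ?_⟩
    rw [pi_eq_iff_of_ge m (by omega) hmem hg, add_sub_cancel_left, show n - m = h + 1 by omega]
    exact hE

lemma card_Ih (h : ℕ) (g : F[X]) : (Ih h g).card = Fintype.card F ^ (h + 1) := by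
  rw [Ih, Finset.card_image_of_injective _ (add_right_injective g), card_Dle]

lemma fiber_card {n : ℕ} (hn : m ≤ n) (u : UU F m) :
    ((Mn F n).filter (fun f => pi m f = u)).card = Fintype.card F ^ (n - m) := by
  obtain ⟨g, hg, rfl⟩ := exists_rep m hn u
  rcases Nat.eq_or_lt_of_le hn with rfl | hlt
  · rw [Nat.sub_self, pow_zero, Finset.card_eq_one]
    refine ⟨g, ?_⟩
    ext f
    rw [Finset.mem_filter, Finset.mem_singleton]
    constructor
    · rintro ⟨hf, h⟩; exact pi_inj_of_le m le_rfl hf hg h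
    · rintro rfl; exact ⟨hg, rfl⟩
  · rw [fiber_eq m (n := n) (h := n - m - 1) (by omega) hg, card_Ih]
    congr 1; omega

lemma card_UU : Fintype.card (UU F m) = Fintype.card F ^ m := by
  rw [← card_Mn (F := F) m, Finset.card_eq_sum_card_fiberwise (f := pi m) (t := Finset.univ)
    (fun _ _ => Finset.mem_coe.2 (Finset.mem_univ _))]
  simp [fiber_card m le_rfl]

end units
end LV

open Polynomial Finset Filter
open scoped Classical
set_option linter.unusedSectionVars false
namespace LV

section frob
variable (F : Type) [Field F] [Fintype F] (k : Type) [Field k] [Algebra F k]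

/-- q-power Frobenius -/
noncomputable abbrev fr : k →ₐ[F] k := FiniteField.frobeniusAlgHom F k

lemma fr_apply (a : k) : fr F k a = a ^ Fintype.card F := rfl

lemma fr_pow_apply (i : ℕ) (a : k) : (fr F k ^ i) a = a ^ Fintype.card F ^ i := by
  induction i generalizing a with
  | zero => simp
  | succ i ih => rw [pow_succ', AlgHom.mul_apply, ih, fr_apply, ← pow_mul, pow_succ]

lemma fixed (b : k) (hb : b ^ Fintype.card F = b) : ∃ c : F, algebraMap F k c = b := by
  have h1 : (X ^ Fintype.card F - X : F[X]) = ∏ c : F, (X - C c) := by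
    have hr := FiniteField.roots_X_pow_card_sub_X F
    have hm : (X ^ Fintype.card F - X : F[X]).Monic := by
      apply monic_X_pow_sub
      rw [degree_X]; exact_mod_cast Fintype.one_lt_card
    have h3 := Polynomial.prod_multiset_X_sub_C_of_monic_of_roots_card_eq hm (by
      rw [hr, FiniteField.X_pow_card_sub_X_natDegree_eq F Fintype.one_lt_card]; rfl)
    rw [hr] at h3
    exact h3.symm
  have h2 := congrArg (aeval b) h1
  simp only [map_sub, map_pow, aeval_X, map_prod, aeval_C, hb, sub_self] at h2
  obtain ⟨c, _, hc⟩ := Finset.prod_eq_zero_iff.1 h2.symm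
  exact ⟨c, (sub_eq_zero.1 hc).symm⟩

variable {F k}

lemma exists_f [IsAlgClosed k] [Algebra.IsAlgebraic F k] (α : k) (y : ℕ)
    (hα : α ^ Fintype.card F ^ y = α) :
    ∃ f : F[X], f.Monic ∧ f.map (algebraMap F k) =
      ∏ i ∈ Finset.range y, (X - C (α ^ Fintype.card F ^ i)) ∧
      (minpoly F α).natDegree ∣ y ∧ f = minpoly F α ^ (y / (minpoly F α).natDegree) := by
  set q := Fintype.card F
  set g : k[X] := ∏ i ∈ Finset.range y, (X - C (α ^ q ^ i)) with hg
  have hgm : g.Monic := monic_prod_of_monic _ _ (fun i _ => monic_X_sub_C _)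
  have hgd : g.natDegree = y := by
    rw [hg, natDegree_prod_of_monic _ _ (fun i _ => monic_X_sub_C _)]
    simp only [natDegree_X_sub_C]; simp
  have hfix : g.map (fr F k : k →+* k) = g := by
    rw [hg, Polynomial.map_prod]
    have h1 : ∀ i, Polynomial.map (fr F k : k →+* k) (X - C (α ^ q ^ i)) = X - C (α ^ q ^ (i + 1)) := by
      intro i
      rw [Polynomial.map_sub, map_X, map_C]
      congr 2
      show (α ^ q ^ i) ^ q = _
      rw [← pow_mul, pow_succ]
    rw [Finset.prod_congr rfl (fun i _ => h1 i)]
    rcases y with _ | y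
    · simp
    · rw [Finset.prod_range_succ, Finset.prod_range_succ', hα, pow_zero, pow_one]
  obtain ⟨f, hfg, hfd, hfm⟩ := Polynomial.lifts_and_natDegree_eq_and_monic
    (f := algebraMap F k) (p := g) (by
      rw [Polynomial.lifts_iff_coeff_lifts]; intro n
      apply fixed
      have := congrArg (fun p => coeff p n) hfix
      simpa using this) hgm
  have hαi : IsIntegral F α := Algebra.IsIntegral.isIntegral α
  set P := minpoly F α with hP
  have hPm : P.Monic := minpoly.monic hαi
  have hPi : Irreducible P := minpoly.irreducible hαi
  have hfac : ∀ P' ∈ UniqueFactorizationMonoid.normalizedFactors f, P' = P := by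
    intro P' hP'
    have hi : Irreducible P' := UniqueFactorizationMonoid.irreducible_of_normalized_factor _ hP'
    have hd : P' ∣ f := UniqueFactorizationMonoid.dvd_of_mem_normalizedFactors hP'
    have hm : P'.Monic := by
      rw [← UniqueFactorizationMonoid.normalize_normalized_factor _ hP']
      exact Polynomial.monic_normalize hi.ne_zero
    obtain ⟨r, hr⟩ := IsAlgClosed.exists_aeval_eq_zero k P' (degree_pos_of_irreducible hi).ne'
    have h1 : eval r g = 0 := by
      rw [← hfg, eval_map_algebraMap]
      obtain ⟨w, hw⟩ := hd
      rw [hw, map_mul, hr, zero_mul]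
    rw [hg, eval_prod] at h1
    obtain ⟨i, _, hi'⟩ := Finset.prod_eq_zero_iff.1 h1
    rw [eval_sub, eval_X, eval_C, sub_eq_zero] at hi'
    rw [hi', ← fr_pow_apply F k, aeval_algHom_apply] at hr
    have h2 : aeval α P' = 0 := (fr F k ^ i).toRingHom.injective (by rw [map_zero]; exact hr)
    exact minpoly.eq_of_irreducible_of_monic hi h2 hm
  have h3 := Multiset.eq_replicate_of_mem hfac
  set n := Multiset.card (UniqueFactorizationMonoid.normalizedFactors f)
  have h4 : f = P ^ n := by
    have h5 := UniqueFactorizationMonoid.prod_normalizedFactors_eq hfm.ne_zero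
    rw [h3, Multiset.prod_replicate, hfm.normalize_eq_self] at h5
    exact h5.symm
  have h6 : y = n * P.natDegree := by
    rw [← hgd, ← hfd, h4, natDegree_pow]
  refine ⟨f, hfm, hfg, ⟨n, by rw [h6, mul_comm]⟩, ?_⟩
  rw [h4, h6, Nat.mul_div_cancel _ hPi.natDegree_pos]

end frob

section points
variable {F : Type} [Field F] [Fintype F] {m : ℕ}

/-- character values -/
noncomputable def ch (χ : AddChar (Additive (UU F m)) ℂ) (f : F[X]) : ℂ := χ (Additive.ofMul (pi m f))

/-- prime power sums -/
noncomputable def psi (χ : AddChar (Additive (UU F m)) ℂ) (x : ℕ) : ℂ :=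
  ∑ d ∈ x.divisors, ∑ P ∈ Px F d, (d : ℂ) * ch χ (P ^ (x / d))

variable (F) in
/-- points of the line over the degree y extension -/
noncomputable def TT (k : Type) [Field k] (y : ℕ) : Finset k :=
  (X ^ Fintype.card F ^ y - X : k[X]).roots.toFinset

variable {k : Type} [Field k] [Algebra F k]

lemma mem_TT {y : ℕ} (hy : y ≠ 0) {α : k} : α ∈ TT F k y ↔ α ^ Fintype.card F ^ y = α := by
  rw [TT, Multiset.mem_toFinset, mem_roots (FiniteField.X_pow_card_pow_sub_X_ne_zero k hy Fintype.one_lt_card)]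
  simp [sub_eq_zero]

lemma card_TT [IsAlgClosed k] {y : ℕ} (hy : y ≠ 0) : (TT F k y).card = Fintype.card F ^ y := by
  obtain ⟨p, hc⟩ := CharP.exists F
  obtain ⟨n, hp, hn⟩ := FiniteField.card F p
  have hck : CharP k p := charP_of_injective_algebraMap (algebraMap F k).injective p
  have hsep : (X ^ Fintype.card F ^ y - X : k[X]).Separable :=
    galois_poly_separable p _ (by rw [hn, ← pow_mul]; exact dvd_pow_self p (by positivity))
  rw [TT, Multiset.toFinset_card_of_nodup (nodup_roots hsep),
    ← (IsAlgClosed.splits (X ^ Fintype.card F ^ y - X : k[X])).natDegree_eq_card_roots,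
    FiniteField.X_pow_card_pow_sub_X_natDegree_eq k hy Fintype.one_lt_card]

lemma fiber_TT [IsAlgClosed k] [Algebra.IsAlgebraic F k] {y d : ℕ} (hy : y ≠ 0) (hd : d ∣ y) {P : F[X]}
    (hP : P ∈ Px F d) : ((TT F k y).filter (fun α => minpoly F α = P)).card = d := by
  obtain ⟨hm, hdeg, hi⟩ := mem_Px.1 hP
  have h1 : (TT F k y).filter (fun α => minpoly F α = P) = (P.rootSet k).toFinset := by
    ext α
    rw [Finset.mem_filter, Set.mem_toFinset, mem_TT hy, mem_rootSet]
    constructor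
    · rintro ⟨_, rfl⟩
      exact ⟨hm.ne_zero, minpoly.aeval F α⟩
    · rintro ⟨_, h⟩
      refine ⟨?_, (minpoly.eq_of_irreducible_of_monic hi h hm).symm⟩
      have h2 := hi.natDegree_dvd_iff_dvd_X_pow_card_pow_sub_X (n := y)
      rw [hdeg] at h2
      obtain ⟨w, hw⟩ := h2.1 hd
      have h3 := congrArg (aeval α) hw
      rw [map_mul, h, zero_mul, map_sub, map_pow, aeval_X, Nat.card_eq_fintype_card] at h3
      exact sub_eq_zero.1 h3
  rw [h1, Set.toFinset_card, card_rootSet_eq_natDegree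
    (PerfectField.separable_of_irreducible hi) (IsAlgClosed.splits _), hdeg]

lemma psi_eq (k : Type) [Field k] [Algebra F k] [IsAlgClosed k] [Algebra.IsAlgebraic F k] {y : ℕ} (hy : y ≠ 0)
    (χ : AddChar (Additive (UU F m)) ℂ) :
    psi χ y = ∑ α ∈ TT F k y, ch χ (minpoly F α ^ (y / (minpoly F α).natDegree)) := by
  have h1 : ∀ α ∈ TT F k y, (minpoly F α).natDegree ∈ y.divisors := by
    intro α hα
    obtain ⟨f, _, _, h, _⟩ := exists_f (F := F) α y ((mem_TT hy).1 hα)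
    exact Nat.mem_divisors.2 ⟨h, hy⟩
  rw [← Finset.sum_fiberwise_of_maps_to h1, psi]
  refine Finset.sum_congr rfl (fun d hd => ?_)
  have h2 : ∀ α ∈ (TT F k y).filter (fun α => (minpoly F α).natDegree = d), minpoly F α ∈ Px F d := by
    intro α hα
    have hαi : IsIntegral F α := Algebra.IsIntegral.isIntegral α
    exact mem_Px.2 ⟨minpoly.monic hαi, (Finset.mem_filter.1 hα).2, minpoly.irreducible hαi⟩
  rw [← Finset.sum_fiberwise_of_maps_to h2]
  refine Finset.sum_congr rfl (fun P hP => ?_)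
  have h3 : ((TT F k y).filter (fun α => (minpoly F α).natDegree = d)).filter (fun α => minpoly F α = P)
      = (TT F k y).filter (fun α => minpoly F α = P) := by
    ext α
    simp only [Finset.mem_filter]
    constructor
    · rintro ⟨⟨a, _⟩, b⟩; exact ⟨a, b⟩
    · rintro ⟨a, b⟩; exact ⟨⟨a, by rw [b]; exact (mem_Px.1 hP).2.1⟩, b⟩
  rw [h3, Finset.sum_congr rfl (g := fun _ => ch χ (P ^ (y / d)))]
  · rw [Finset.sum_const, fiber_TT hy (Nat.dvd_of_mem_divisors hd) hP, nsmul_eq_mul]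
  · intro α hα
    rw [(Finset.mem_filter.1 hα).2, (mem_Px.1 hP).2.1]

end points
end LV

open Polynomial Finset Filter
open scoped Classical
set_option linter.unusedSectionVars false
namespace LV

section series
variable {F : Type} [Field F] [Fintype F] {k : Type} [Field k] [Algebra F k]

lemma reverse_X_sub (a : k) : (X - C a : k[X]).reverse = 1 - C a * X := by
  ext n
  rw [coeff_reverse, natDegree_X_sub_C]
  rcases n with _ | _ | n
  · simp [revAt_le]
  · rw [revAt_le (by omega)]; simp [coeff_one]
  · rw [revAt_eq_self_of_lt (by omega)]; simp [coeff_X, coeff_one]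

lemma reverse_prod (y : ℕ) (a : ℕ → k) :
    (∏ i ∈ Finset.range y, (X - C (a i)) : k[X]).reverse = ∏ i ∈ Finset.range y, (1 - C (a i) * X) := by
  induction y with
  | zero => simp only [Finset.range_zero, Finset.prod_empty]; rw [← C_1, reverse_C]
  | succ y ih => rw [Finset.prod_range_succ, reverse_mul_of_domain, ih, reverse_X_sub, Finset.prod_range_succ]

lemma reverse_map (f : F[X]) : (f.map (algebraMap F k)).reverse = f.reverse.map (algebraMap F k) := by
  ext n
  rw [coeff_reverse, coeff_map, coeff_map, coeff_reverse, natDegree_map]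

lemma series_one (α : k) (z : ℕ → k) (hR : Rel (Fintype.card F) α z) :
    PowerSeries.map (fr F k : k →+* k) (PowerSeries.mk z) =
      ((1 - C α * X : k[X]) : PowerSeries k) * PowerSeries.mk z := by
  ext n
  rw [PowerSeries.coeff_map, PowerSeries.coeff_mk]
  show z n ^ Fintype.card F = _
  have h1 : ((1 - C α * X : k[X]) : PowerSeries k) = 1 - PowerSeries.C α * PowerSeries.X := by simp
  rw [h1, sub_mul, one_mul, map_sub, PowerSeries.coeff_mk, mul_assoc, PowerSeries.coeff_C_mul]
  rcases n with _ | n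
  · simp [hR.1]
  · rw [PowerSeries.coeff_succ_X_mul, PowerSeries.coeff_mk, hR.2 n]

lemma series_y (α : k) (z : ℕ → k) (hR : Rel (Fintype.card F) α z) (y : ℕ) :
    PowerSeries.map ((fr F k ^ y : k →ₐ[F] k) : k →+* k) (PowerSeries.mk z) =
      ((∏ i ∈ Finset.range y, (1 - C (α ^ Fintype.card F ^ i) * X) : k[X]) : PowerSeries k)
        * PowerSeries.mk z := by
  induction y with
  | zero =>
    ext n
    simp
  | succ y ih =>
    have h1 : PowerSeries.map ((fr F k ^ (y + 1) : k →ₐ[F] k) : k →+* k) (PowerSeries.mk z) =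
        PowerSeries.map ((fr F k ^ y : k →ₐ[F] k) : k →+* k)
          (PowerSeries.map (fr F k : k →+* k) (PowerSeries.mk z)) := by
      ext n
      simp only [PowerSeries.coeff_map, PowerSeries.coeff_mk]
      show (fr F k ^ (y + 1)) (z n) = (fr F k ^ y) (fr F k (z n))
      rw [pow_succ, AlgHom.mul_apply]
    have h2 : PowerSeries.map ((fr F k ^ y : k →ₐ[F] k) : k →+* k) ((1 - C α * X : k[X]) : PowerSeries k)
        = ((1 - C (α ^ Fintype.card F ^ y) * X : k[X]) : PowerSeries k) := by
      have h3 := fr_pow_apply F k y α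
      simp only [Polynomial.coe_sub, Polynomial.coe_one, Polynomial.coe_mul, Polynomial.coe_C,
        Polynomial.coe_X, map_sub, map_one, map_mul, PowerSeries.map_C, PowerSeries.map_X]
      congr 3
    rw [h1, series_one α z hR, map_mul, ih, h2, Finset.prod_range_succ, Polynomial.coe_mul]
    ring

lemma frob_rel {m : ℕ} (α : k) (z : ℕ → k) (hR : Rel (Fintype.card F) α z) (y : ℕ) (f g : F[X])
    (hf : f.map (algebraMap F k) = ∏ i ∈ Finset.range y, (X - C (α ^ Fintype.card F ^ i)))
    (hg : g.Monic) (hfg : ∀ i ≤ m, f.reverse.coeff i = g.reverse.coeff i) (j : ℕ) (hj : j ≤ m) :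
    (∑ a ∈ Finset.range (j + 1), algebraMap F k (PowerSeries.coeff a ((g.reverse : PowerSeries F)⁻¹))
      * z (j - a)) ^ Fintype.card F ^ y = z j := by
  set U : PowerSeries F := (g.reverse : PowerSeries F)⁻¹ with hU
  have hU1 : U * (g.reverse : PowerSeries F) = 1 := by
    apply PowerSeries.inv_mul_cancel
    have : PowerSeries.constantCoeff (g.reverse : PowerSeries F) = g.reverse.coeff 0 := by simp
    rw [this, coeff_zero_reverse, hg]
    exact one_ne_zero
  have h0 : (f.reverse.map (algebraMap F k)) = ∏ i ∈ Finset.range y, (1 - C (α ^ Fintype.card F ^ i) * X) := by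
    rw [← reverse_map, hf, reverse_prod]
  have h1 : PowerSeries.map ((fr F k ^ y : k →ₐ[F] k) : k →+* k) (PowerSeries.mk z) =
      PowerSeries.map (algebraMap F k) (f.reverse : PowerSeries F) * PowerSeries.mk z := by
    rw [series_y α z hR y, ← h0]
    congr 1
    ext n; simp
  obtain ⟨W, hW⟩ : (PowerSeries.X : PowerSeries F) ^ (m + 1) ∣
      (f.reverse : PowerSeries F) - (g.reverse : PowerSeries F) := by
    rw [PowerSeries.X_pow_dvd_iff]
    intro i hi
    rw [map_sub, Polynomial.coeff_coe, Polynomial.coeff_coe, hfg i (by omega), sub_self]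
  have h2 : PowerSeries.map (algebraMap F k) U *
      PowerSeries.map ((fr F k ^ y : k →ₐ[F] k) : k →+* k) (PowerSeries.mk z) =
      PowerSeries.mk z + PowerSeries.X ^ (m + 1) * (PowerSeries.map (algebraMap F k) (U * W) * PowerSeries.mk z) := by
    rw [h1, ← mul_assoc, ← map_mul, sub_eq_iff_eq_add.1 hW, mul_add, hU1]
    simp only [map_add, map_mul, map_one, map_pow, PowerSeries.map_X]
    ring
  have h3 := congrArg (PowerSeries.coeff j) h2
  rw [map_add, PowerSeries.coeff_X_pow_mul', if_neg (by omega), add_zero, PowerSeries.coeff_mk,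
    PowerSeries.coeff_mul, Finset.Nat.sum_antidiagonal_eq_sum_range_succ_mk] at h3
  rw [← h3, ← fr_pow_apply F k, map_sum]
  refine Finset.sum_congr rfl (fun a ha => ?_)
  rw [map_mul, AlgHom.commutes, PowerSeries.coeff_map, PowerSeries.coeff_map, PowerSeries.coeff_mk]
  rfl

end series

section count
variable {F : Type} [Field F] [Fintype F]

/-- Points with a given class -/
noncomputable def Tu (k : Type) [Field k] [Algebra F k] (m y : ℕ) (u : UU F m) : Finset k :=
  (TT F k y).filter (fun α => pi m (minpoly F α ^ (y / (minpoly F α).natDegree)) = u)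

lemma n_bound (k : Type) [Field k] [Algebra F k] [IsAlgClosed k] [Algebra.IsAlgebraic F k] (m : ℕ) :
    ∃ C P0 : ℕ, ∀ y P : ℕ, P = Fintype.card F ^ y → P0 ≤ P → 0 < y → ∀ u : UU F m,
      (Tu k m (2 * y) u).card * Fintype.card F ^ m ≤ P * P + C * P := by
  obtain ⟨C, P0, hC⟩ := curve_bound F k m
  refine ⟨C, P0, fun y P hP hP0 hy u => ?_⟩
  have hPP : P * P = Fintype.card F ^ (2 * y) := by rw [hP, two_mul, pow_add]
  have hq : 2 ≤ Fintype.card F := Fintype.one_lt_card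
  choose ρ hρ using exists_as k (Fintype.card F) hq
  obtain ⟨g, hg, rfl⟩ := pi_surj m u
  have hg' := mem_Mn.1 hg
  let ι := Tu k m (2 * y) (pi m g) × (Fin m → F)
  let px : ι → k := fun i => i.1.1
  let cc : (Fin m → F) → ℕ → F := fun c j => if h : j < m then c ⟨j, h⟩ else 0
  let pz : ι → ℕ → k := fun i n => Nat.rec 1 (fun j w => ρ (i.1.1 * w) + algebraMap F k (cc i.2 j)) n
  have hpz0 : ∀ i, pz i 0 = 1 := fun i => rfl
  have hpzs : ∀ i j, pz i (j + 1) = ρ (px i * pz i j) + algebraMap F k (cc i.2 j) := fun i j => rfl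
  have hRel : ∀ i, Rel (Fintype.card F) (px i) (pz i) := by
    intro i
    refine ⟨hpz0 i, fun j => ?_⟩
    have h1 : pz i (j + 1) ^ Fintype.card F = fr F k (pz i (j + 1)) := rfl
    rw [h1, hpzs, map_add, fr_apply, AlgHom.commutes, hρ]
    ring
  have hT : ∀ i : ι, px i ^ Fintype.card F ^ (2 * y) = px i ∧
      pi m (minpoly F (px i) ^ (2 * y / (minpoly F (px i)).natDegree)) = pi m g := by
    intro i
    have h1 : px i ∈ Tu k m (2 * y) (pi m g) := i.1.2
    have h2 := Finset.mem_filter.1 h1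
    exact ⟨(mem_TT (by omega)).1 h2.1, h2.2⟩
  have hinj : ∀ i j, px i = px j → (∀ n ≤ m, pz i n = pz j n) → i = j := by
    intro i j h1 h2
    refine Prod.ext (Subtype.ext h1) (funext fun a => ?_)
    have h3 := h2 (a + 1) (by omega)
    rw [hpzs, hpzs, h1, h2 a (by omega)] at h3
    have h4 := (algebraMap F k).injective (add_left_cancel h3)
    simp only [cc, a.2, dif_pos] at h4
    exact h4
  have hcard := hC y P hP hP0 ι px pz (fun a => PowerSeries.coeff a ((g.reverse : PowerSeries F)⁻¹))
    hRel hinj ?_ ?_ ?_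
  · rw [Fintype.card_prod, Fintype.card_coe] at hcard
    simpa using hcard
  · have : PowerSeries.constantCoeff (g.reverse : PowerSeries F) = g.reverse.coeff 0 := by simp
    rw [PowerSeries.coeff_zero_eq_constantCoeff_apply, PowerSeries.constantCoeff_inv, this,
      coeff_zero_reverse, hg'.1, inv_one]
  · intro i; rw [hPP]; exact (hT i).1
  · intro i j hj
    rw [hPP]
    obtain ⟨f, hfm, hfg, _, hf⟩ := exists_f (F := F) (px i) (2 * y) (hT i).1
    refine frob_rel (m := m) (px i) (pz i) (hRel i) (2 * y) f g hfg hg'.1 ?_ j hj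
    rw [← pi_eq_iff m hfm hg'.1, hf]
    exact (hT i).2

lemma norm_ch {m : ℕ} (χ : AddChar (Additive (UU F m)) ℂ) (f : F[X]) : ‖ch χ f‖ = 1 :=
  AddChar.norm_apply _ _

theorem psi_even_bound (m : ℕ) : ∃ C : ℝ, ∃ y0 : ℕ, ∀ y, y0 ≤ y →
    ∀ χ : AddChar (Additive (UU F m)) ℂ, χ ≠ 0 →
      ‖psi χ (2 * y)‖ ≤ C * (Fintype.card F : ℝ) ^ y := by
  obtain ⟨C, P0, hC⟩ := n_bound (F := F) (AlgebraicClosure F) m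
  refine ⟨2 * C, P0 + 1, fun y hy χ hχ => ?_⟩
  set q := Fintype.card F
  have hq : 2 ≤ q := Fintype.one_lt_card
  have hy' : P0 ≤ q ^ y := le_trans (by omega) (Nat.lt_pow_self (n := y) (by omega : 1 < q)).le
  set k := AlgebraicClosure F
  let n : UU F m → ℕ := fun u => (Tu k m (2 * y) u).card
  have hn : ∀ u, n u * q ^ m ≤ q ^ y * q ^ y + C * q ^ y := fun u => hC y _ rfl hy' (by omega) u
  have hsum : ∑ u, n u = q ^ (2 * y) := by
    rw [← card_TT (F := F) (k := k) (y := 2 * y) (by omega), Finset.card_eq_sum_card_fiberwise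
      (f := fun α => pi m (minpoly F α ^ (2 * y / (minpoly F α).natDegree))) (t := Finset.univ)
      (fun _ _ => Finset.mem_coe.2 (Finset.mem_univ _))]
    rfl
  have hpsi : psi χ (2 * y) = ∑ u : UU F m, (n u : ℂ) * χ (Additive.ofMul u) := by
    rw [psi_eq k (by omega), ← Finset.sum_fiberwise_of_maps_to
      (g := fun α => pi m (minpoly F α ^ (2 * y / (minpoly F α).natDegree))) (t := Finset.univ)
      (fun _ _ => Finset.mem_univ _)]
    refine Finset.sum_congr rfl (fun u _ => ?_)
    rw [Finset.sum_congr rfl (g := fun _ => χ (Additive.ofMul u))]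
    · rw [Finset.sum_const, nsmul_eq_mul]; rfl
    · intro α hα
      rw [ch, (Finset.mem_filter.1 hα).2]
  have hχ0 : ∑ u : UU F m, χ (Additive.ofMul u) = 0 := by
    have h1 := AddChar.sum_eq_ite χ
    rw [if_neg hχ] at h1
    rw [← h1]
    exact Fintype.sum_equiv Additive.ofMul _ _ (fun _ => rfl)
  set M : ℝ := (q : ℝ) ^ m with hM
  have hMpos : 0 < M := by positivity
  set Q : ℝ := (q : ℝ) ^ (2 * y) with hQ
  let D : UU F m → ℝ := fun u => n u * M - Q
  have hD : ∀ u, D u ≤ C * q ^ y := by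
    intro u
    have h1 : (n u : ℝ) * (q : ℝ) ^ m ≤ (q : ℝ) ^ y * (q : ℝ) ^ y + C * (q : ℝ) ^ y := by exact_mod_cast hn u
    have h2 : Q = (q : ℝ) ^ y * (q : ℝ) ^ y := by rw [hQ, two_mul, pow_add]
    simp only [D]; rw [h2]; linarith
  have hcardU : (Fintype.card (UU F m) : ℝ) = M := by rw [card_UU]; push_cast; rfl
  have hDs : ∑ u, D u = 0 := by
    simp only [D, Finset.sum_sub_distrib, ← Finset.sum_mul]
    have : ∑ u, (n u : ℝ) = Q := by rw [hQ]; exact_mod_cast hsum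
    rw [this, Finset.sum_const, Finset.card_univ, nsmul_eq_mul, hcardU]; ring
  have hDabs : ∑ u, |D u| ≤ 2 * (M * (C * q ^ y)) := by
    have h1 : ∀ u, |D u| ≤ 2 * (C * q ^ y) - D u := by
      intro u
      rw [abs_le]
      have h0 : (0 : ℝ) ≤ C * q ^ y := by positivity
      constructor <;> linarith [hD u]
    calc ∑ u, |D u| ≤ ∑ u, (2 * (C * (q : ℝ) ^ y) - D u) := Finset.sum_le_sum (fun u _ => h1 u)
      _ = _ := by
        rw [Finset.sum_sub_distrib, hDs, Finset.sum_const, Finset.card_univ, nsmul_eq_mul, hcardU]; ring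
  have h2 : (M : ℂ) * psi χ (2 * y) = ∑ u : UU F m, (D u : ℂ) * χ (Additive.ofMul u) := by
    simp only [D]; push_cast
    simp only [sub_mul, Finset.sum_sub_distrib]
    rw [← Finset.mul_sum, hχ0, mul_zero, sub_zero, hpsi, Finset.mul_sum]
    exact Finset.sum_congr rfl (fun u _ => by ring)
  have h3 : M * ‖psi χ (2 * y)‖ ≤ 2 * (M * (C * q ^ y)) := by
    calc M * ‖psi χ (2 * y)‖ = ‖(M : ℂ) * psi χ (2 * y)‖ := by
          rw [norm_mul, Complex.norm_real, Real.norm_of_nonneg hMpos.le]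
      _ ≤ ∑ u : UU F m, ‖(D u : ℂ) * χ (Additive.ofMul u)‖ := by rw [h2]; exact norm_sum_le _ _
      _ = ∑ u, |D u| := by
        refine Finset.sum_congr rfl (fun u _ => ?_)
        rw [norm_mul, AddChar.norm_apply, mul_one, Complex.norm_real, Real.norm_eq_abs]
      _ ≤ _ := hDabs
  nlinarith

end count
end LV

open Polynomial Finset Filter
open scoped Classical
set_option linter.unusedSectionVars false
namespace LV
open UniqueFactorizationMonoid

section conv
variable {F : Type} [Field F] [Fintype F] {R : Type} [CommRing R]

lemma mem_nf {G P : F[X]} (hP : P ∈ normalizedFactors G) :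
    P.Monic ∧ Irreducible P ∧ P ∣ G := by
  have hi : Irreducible P := irreducible_of_normalized_factor _ hP
  refine ⟨?_, hi, dvd_of_mem_normalizedFactors hP⟩
  rw [← normalize_normalized_factor _ hP]
  exact Polynomial.monic_normalize hi.ne_zero

lemma pow_dvd_iff_count {P G : F[X]} (hP : P.Monic) (hi : Irreducible P) (hG : G ≠ 0) (k : ℕ) :
    P ^ k ∣ G ↔ k ≤ (normalizedFactors G).count P := by
  rw [pow_dvd_iff_le_emultiplicity, emultiplicity_eq_count_normalizedFactors hi hG,
    hP.normalize_eq_self]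
  exact Nat.cast_le

lemma count_eq_card {n d : ℕ} {P G : F[X]} (hP : P ∈ Px F d) (hG : G ∈ Mn F n) :
    (normalizedFactors G).count P = ((Icc 1 n).filter (fun k => P ^ k ∣ G)).card := by
  obtain ⟨hm, hd, hi⟩ := mem_Px.1 hP
  obtain ⟨hGm, hGd⟩ := mem_Mn.1 hG
  set c := (normalizedFactors G).count P with hc
  have h1 : c ≤ n := by
    have h2 := (pow_dvd_iff_count hm hi hGm.ne_zero c).2 le_rfl
    have h3 := natDegree_le_of_dvd h2 hGm.ne_zero
    rw [natDegree_pow, hGd] at h3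
    exact le_trans (Nat.le_mul_of_pos_right _ hi.natDegree_pos) h3
  have h4 : (Icc 1 n).filter (fun k => P ^ k ∣ G) = Icc 1 c := by
    ext k
    rw [Finset.mem_filter, mem_Icc, mem_Icc, pow_dvd_iff_count hm hi hGm.ne_zero]
    omega
  rw [h4]; simp

/-- additive function -/
noncomputable def rr (w : F[X] → R) (G : F[X]) : R := ((normalizedFactors G).map w).sum

lemma Px_disj (s : Set ℕ) : s.PairwiseDisjoint (Px F) := by
  intro a _ b _ hab
  rw [Function.onFun, Finset.disjoint_left]
  intro P hP hP'
  exact hab ((mem_Px.1 hP).2.1.symm.trans (mem_Px.1 hP').2.1)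

lemma rr_eq (w : F[X] → R) {n : ℕ} {G : F[X]} (hG : G ∈ Mn F n) :
    rr w G = ∑ d ∈ Icc 1 n, ∑ P ∈ Px F d, ∑ k ∈ Icc 1 n, if P ^ k ∣ G then w P else 0 := by
  obtain ⟨hGm, hGd⟩ := mem_Mn.1 hG
  rw [rr, Finset.sum_multiset_map_count,
    Finset.sum_subset (s₂ := (Icc 1 n).biUnion (Px F)), Finset.sum_biUnion (Px_disj _)]
  · refine Finset.sum_congr rfl (fun d _ => Finset.sum_congr rfl (fun P hP => ?_))
    rw [← Finset.sum_filter, Finset.sum_const, count_eq_card hP hG]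
  · intro P hP
    rw [Multiset.mem_toFinset] at hP
    obtain ⟨h1, h2, h3⟩ := mem_nf hP
    rw [Finset.mem_biUnion]
    refine ⟨P.natDegree, mem_Icc.2 ⟨h2.natDegree_pos, ?_⟩, mem_Px.2 ⟨h1, rfl, h2⟩⟩
    rw [← hGd]; exact natDegree_le_of_dvd h3 hGm.ne_zero
  · intro P _ hP
    rw [Multiset.mem_toFinset] at hP
    rw [Multiset.count_eq_zero_of_notMem hP, zero_smul]

lemma sum_dvd (H : F[X] → R) {n x : ℕ} (hx : x ≤ n) {Q : F[X]} (hQ : Q ∈ Mn F x) :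
    ∑ G ∈ Mn F n, (if Q ∣ G then H G else 0) = ∑ M ∈ Mn F (n - x), H (Q * M) := by
  obtain ⟨hQm, hQd⟩ := mem_Mn.1 hQ
  rw [← Finset.sum_filter]
  symm
  refine Finset.sum_bij (fun M _ => Q * M) ?_ ?_ ?_ ?_
  · intro M hM
    obtain ⟨hMm, hMd⟩ := mem_Mn.1 hM
    rw [Finset.mem_filter, mem_Mn]
    exact ⟨⟨hQm.mul hMm, by rw [hQm.natDegree_mul hMm, hQd, hMd]; omega⟩, dvd_mul_right _ _⟩
  · intro M _ M' _ h
    exact mul_left_cancel₀ hQm.ne_zero h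
  · intro G hG
    rw [Finset.mem_filter, mem_Mn] at hG
    obtain ⟨⟨hGm, hGd⟩, M, rfl⟩ := hG
    have hMm : M.Monic := hQm.of_mul_monic_left hGm
    refine ⟨M, mem_Mn.2 ⟨hMm, ?_⟩, rfl⟩
    rw [hQm.natDegree_mul hMm, hQd] at hGd
    omega
  · intros; rfl

lemma sum_dvd_big (H : F[X] → R) {n x : ℕ} (hx : n < x) {Q : F[X]} (hQ : Q ∈ Mn F x) :
    ∑ G ∈ Mn F n, (if Q ∣ G then H G else 0) = 0 := by
  apply Finset.sum_eq_zero
  intro G hG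
  obtain ⟨hGm, hGd⟩ := mem_Mn.1 hG
  rw [if_neg]
  intro h
  have := natDegree_le_of_dvd h hGm.ne_zero
  rw [(mem_Mn.1 hQ).2, hGd] at this
  omega

lemma Px_pow_mem {d k : ℕ} {P : F[X]} (hP : P ∈ Px F d) : P ^ k ∈ Mn F (d * k) := by
  obtain ⟨h1, h2, _⟩ := mem_Px.1 hP
  exact mem_Mn.2 ⟨h1.pow k, by rw [natDegree_pow, h2, mul_comm]⟩

lemma sum_pairs (n : ℕ) (g : ℕ → ℕ → R) :
    ∑ d ∈ Icc 1 n, ∑ k ∈ Icc 1 n, (if d * k ≤ n then g d k else 0) =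
      ∑ x ∈ Icc 1 n, ∑ d ∈ x.divisors, g d (x / d) := by
  rw [← Finset.sum_product', ← Finset.sum_filter,
    ← Finset.sum_fiberwise_of_maps_to (g := fun p : ℕ × ℕ => p.1 * p.2) (t := Icc 1 n)]
  · refine Finset.sum_congr rfl (fun x hx => ?_)
    rw [← Nat.sum_divisorsAntidiagonal]
    apply Finset.sum_congr
    · ext ⟨a, b⟩
      rw [mem_Icc] at hx
      simp only [Finset.mem_filter, Finset.mem_product, mem_Icc, Nat.mem_divisorsAntidiagonal]
      constructor
      · rintro ⟨_, h⟩; exact ⟨h, by omega⟩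
      · rintro ⟨h, hx0⟩
        have ha : 0 < a := Nat.pos_of_ne_zero (by rintro rfl; simp at h; omega)
        have hb : 0 < b := Nat.pos_of_ne_zero (by rintro rfl; simp at h; omega)
        have h1 : a ≤ a * b := Nat.le_mul_of_pos_right _ hb
        have h2 : b ≤ a * b := Nat.le_mul_of_pos_left _ ha
        omega
    · intros; rfl
  · rintro ⟨a, b⟩ h
    simp only [Finset.mem_filter, Finset.mem_product, mem_Icc] at h
    rw [mem_Icc]
    exact ⟨Nat.mul_pos (by omega) (by omega), h.2⟩

theorem conv (w H : F[X] → R) (n : ℕ) :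
    ∑ G ∈ Mn F n, rr w G * H G =
      ∑ x ∈ Icc 1 n, ∑ d ∈ x.divisors, ∑ P ∈ Px F d,
        w P * ∑ M ∈ Mn F (n - x), H (P ^ (x / d) * M) := by
  have h1 : ∑ G ∈ Mn F n, rr w G * H G = ∑ d ∈ Icc 1 n, ∑ k ∈ Icc 1 n,
      (if d * k ≤ n then ∑ P ∈ Px F d, w P * ∑ M ∈ Mn F (n - d * k), H (P ^ k * M) else 0) := by
    rw [Finset.sum_congr rfl (fun G hG => by rw [rr_eq w hG])]
    simp only [Finset.sum_mul]
    rw [Finset.sum_comm]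
    refine Finset.sum_congr rfl (fun d _ => ?_)
    rw [Finset.sum_comm, Finset.sum_congr rfl (fun P _ => Finset.sum_comm), Finset.sum_comm]
    refine Finset.sum_congr rfl (fun k _ => ?_)
    have h2 : ∀ P ∈ Px F d, ∑ G ∈ Mn F n, (if P ^ k ∣ G then w P else 0) * H G =
        w P * ∑ G ∈ Mn F n, (if P ^ k ∣ G then H G else 0) := by
      intro P _
      rw [Finset.mul_sum]
      refine Finset.sum_congr rfl (fun G _ => ?_)
      split_ifs <;> simp
    rw [Finset.sum_congr rfl h2]
    split_ifs with h
    · refine Finset.sum_congr rfl (fun P hP => ?_)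
      rw [sum_dvd H h (Px_pow_mem hP)]
    · refine Finset.sum_eq_zero (fun P hP => ?_)
      rw [sum_dvd_big H (by omega) (Px_pow_mem hP), mul_zero]
  rw [h1, sum_pairs n (fun d k => ∑ P ∈ Px F d, w P * ∑ M ∈ Mn F (n - d * k), H (P ^ k * M))]
  refine Finset.sum_congr rfl (fun x _ => Finset.sum_congr rfl (fun d hd => ?_))
  rw [Nat.mul_div_cancel' (Nat.dvd_of_mem_divisors hd)]

lemma rr_mul (w : F[X] → R) {f g : F[X]} (hf : f ≠ 0) (hg : g ≠ 0) : rr w (f * g) = rr w f + rr w g := by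
  rw [rr, normalizedFactors_mul hf hg, Multiset.map_add, Multiset.sum_add]; rfl

lemma rr_one (w : F[X] → R) : rr w 1 = 0 := by
  rw [rr, normalizedFactors_one]; simp

lemma rr_irred (w : F[X] → R) {P : F[X]} (hP : P.Monic) (hi : Irreducible P) : rr w P = w P := by
  rw [rr, normalizedFactors_irreducible hi, hP.normalize_eq_self]; simp

lemma rr_pow (w : F[X] → R) {P : F[X]} (hP : P ≠ 0) (k : ℕ) :
    rr w (P ^ k) = k * rr w P := by
  induction k with
  | zero => simp [rr_one]
  | succ k ih => rw [pow_succ, rr_mul w (pow_ne_zero _ hP) hP, ih]; push_cast; ring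

lemma rr_deg {n : ℕ} {G : F[X]} (hG : G ∈ Mn F n) : rr (fun P => (P.natDegree : R)) G = n := by
  obtain ⟨hm, hd⟩ := mem_Mn.1 hG
  have h1 := prod_normalizedFactors_eq hm.ne_zero
  rw [hm.normalize_eq_self] at h1
  have h2 := congrArg natDegree h1
  rw [natDegree_multiset_prod _ (zero_notMem_normalizedFactors _), hd] at h2
  rw [rr, ← h2, Nat.cast_multiset_sum, Multiset.map_map]
  rfl

end conv
end LV

open Polynomial Finset Filter
open scoped Classical
set_option linter.unusedSectionVars false
namespace LV

section ps
lemma conv_inj (A f g : ℕ → ℂ) (hA : A 0 = 1)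
    (h : ∀ n, ∑ x ∈ Icc 1 n, f x * A (n - x) = ∑ x ∈ Icc 1 n, g x * A (n - x)) (x : ℕ) (hx : 1 ≤ x) :
    f x = g x := by
  induction x using Nat.strong_induction_on with
  | _ x ih =>
    have h1 := h x
    obtain ⟨y, rfl⟩ : ∃ y, x = y + 1 := ⟨x - 1, by omega⟩
    rw [Finset.sum_Icc_succ_top (by omega), Finset.sum_Icc_succ_top (by omega)] at h1
    have h0 : ∑ z ∈ Icc 1 y, f z * A (y + 1 - z) = ∑ z ∈ Icc 1 y, g z * A (y + 1 - z) :=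
      Finset.sum_congr rfl (fun z hz => by
        rw [mem_Icc] at hz
        rw [ih z (by omega) (by omega)])
    rw [h0] at h1
    have h2 := add_left_cancel h1
    simpa [hA] using h2

lemma power_sum {ι : Type} [Fintype ι] (β : ι → ℂ) (C : ℝ) (y0 : ℕ)
    (h : ∀ y, y0 ≤ y → ‖∑ i, β i ^ y‖ ≤ C) (i : ι) : ‖β i‖ ≤ 1 := by
  by_contra hcon
  push Not at hcon
  have : Nonempty ι := ⟨i⟩
  obtain ⟨i0, hi0⟩ := Finite.exists_max (fun i => ‖β i‖)
  set ρ := ‖β i0‖ with hρ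
  have hρ1 : 1 < ρ := lt_of_lt_of_le hcon (hi0 i)
  let θ : ι → ℂ := fun i => β i / ρ
  have hθn : ∀ i, ‖θ i‖ = ‖β i‖ / ρ := by
    intro i; simp only [θ]; rw [norm_div, Complex.norm_real, Real.norm_of_nonneg (by linarith)]
  have hθ1 : ∀ i, ‖θ i‖ ≤ 1 := by
    intro i; rw [hθn, div_le_one (by linarith)]; exact hi0 i
  have hθ0 : ‖θ i0‖ = 1 := by rw [hθn]; exact div_self (by linarith)
  let g : ι → Circle := fun i => if hh : ‖θ i‖ = 1 then ⟨θ i, mem_sphere_zero_iff_norm.2 hh⟩ else 1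
  have hcl := mapClusterPt_one_atTop_pow g
  have hnb : {z : ι → Circle | ∀ i, 1 / 2 < ((z i : ℂ)).re} ∈ nhds (1 : ι → Circle) := by
    have : IsOpen {z : ι → Circle | ∀ i, 1 / 2 < ((z i : ℂ)).re} := by
      rw [Set.ofPred_forall]
      refine isOpen_iInter_of_finite (fun i => ?_)
      refine isOpen_lt continuous_const ?_
      exact Complex.continuous_re.comp (continuous_subtype_val.comp (continuous_apply i))
    refine this.mem_nhds ?_
    intro i; norm_num
  have hfr := hcl.frequently hnb
  have hE1 : ∀ᶠ n : ℕ in atTop, ‖∑ i, θ i ^ n‖ < 1 / 4 := by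
    have h1 : Tendsto (fun n : ℕ => C * (ρ⁻¹) ^ n) atTop (nhds (C * 0)) :=
      (tendsto_pow_atTop_nhds_zero_of_lt_one (by positivity) (inv_lt_one_of_one_lt₀ hρ1)).const_mul C
    have h2 := h1.eventually (gt_mem_nhds (show C * 0 < 1 / 4 by norm_num))
    filter_upwards [h2, eventually_ge_atTop y0] with n h2 h3
    have h4 : ∑ i, θ i ^ n = (∑ i, β i ^ n) / (ρ : ℂ) ^ n := by
      rw [Finset.sum_div]; exact Finset.sum_congr rfl (fun i _ => by simp only [θ]; rw [div_pow])
    rw [h4, norm_div, norm_pow, Complex.norm_real, Real.norm_of_nonneg (by linarith), div_eq_mul_inv,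
      ← inv_pow]
    exact lt_of_le_of_lt (mul_le_mul_of_nonneg_right (h n h3) (by positivity)) h2
  have hE2 : ∀ᶠ n : ℕ in atTop, ‖∑ i ∈ univ.filter (fun i => ¬ ‖θ i‖ = 1), θ i ^ n‖ < 1 / 4 := by
    have h1 : Tendsto (fun n : ℕ => ∑ i ∈ univ.filter (fun i => ¬ ‖θ i‖ = 1), θ i ^ n) atTop
        (nhds (∑ i ∈ univ.filter (fun i => ¬ ‖θ i‖ = 1), (0 : ℂ))) := by
      refine tendsto_finsetSum _ (fun i hi => ?_)
      exact tendsto_pow_atTop_nhds_zero_of_norm_lt_one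
        (lt_of_le_of_ne (hθ1 i) (Finset.mem_filter.1 hi).2)
    rw [Finset.sum_const_zero] at h1
    have h2 := h1.norm
    rw [norm_zero] at h2
    exact h2.eventually (gt_mem_nhds (by norm_num))
  obtain ⟨n, hn1, hn2, hn3⟩ := (hfr.and_eventually (hE1.and hE2)).exists
  rw [← Finset.sum_filter_add_sum_filter_not univ (fun i => ‖θ i‖ = 1)] at hn2
  have h5 : 1 / 2 ≤ (∑ i ∈ univ.filter (fun i => ‖θ i‖ = 1), θ i ^ n).re := by
    rw [Complex.re_sum]
    have h6 : ∀ i ∈ univ.filter (fun i => ‖θ i‖ = 1), 1 / 2 ≤ (θ i ^ n).re := by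
      intro i hi
      have h7 := hn1 i
      have hi' := (Finset.mem_filter.1 hi).2
      have h8 : (((g ^ n) i : Circle) : ℂ) = θ i ^ n := by
        rw [Pi.pow_apply, Circle.coe_pow]
        have h9 : g i = ⟨θ i, mem_sphere_zero_iff_norm.2 hi'⟩ := dif_pos hi'
        rw [h9]
      rw [h8] at h7
      exact h7.le
    have hmem : i0 ∈ univ.filter (fun i => ‖θ i‖ = 1) := Finset.mem_filter.2 ⟨mem_univ _, hθ0⟩
    exact le_trans (h6 i0 hmem)
      (Finset.single_le_sum (f := fun i => (θ i ^ n).re) (fun i hi => le_trans (by norm_num) (h6 i hi)) hmem)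
  have h6 := Complex.re_le_norm (∑ i ∈ univ.filter (fun i => ‖θ i‖ = 1), θ i ^ n)
  have h7 := norm_sub_le (∑ i ∈ univ.filter (fun i => ‖θ i‖ = 1), θ i ^ n +
    ∑ i ∈ univ.filter (fun i => ¬ ‖θ i‖ = 1), θ i ^ n) (∑ i ∈ univ.filter (fun i => ¬ ‖θ i‖ = 1), θ i ^ n)
  rw [add_sub_cancel_right] at h7
  linarith

lemma newton_roots (A : ℕ → ℂ) (f : ℕ → ℂ) (m : ℕ) (hA : A 0 = 1) (hA0 : ∀ n, m < n → A n = 0)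
    (hrec : ∀ n : ℕ, (n : ℂ) * A n = ∑ x ∈ Icc 1 n, f x * A (n - x)) :
    ∃ α : Fin m → ℂ, ∀ x, 1 ≤ x → f x = - ∑ i, α i ^ x := by
  let p : ℂ[X] := ∑ n ∈ Finset.range (m + 1), C (A n) * X ^ (m - n)
  have hcoeff : ∀ n, n ≤ m → p.coeff (m - n) = A n := by
    intro n hn
    simp only [p, finsetSum_coeff, coeff_C_mul_X_pow]
    rw [Finset.sum_eq_single n]
    · simp
    · intro b hb hbn
      rw [Finset.mem_range] at hb
      rw [if_neg (by omega)]
    · intro h; exact absurd (Finset.mem_range.2 (by omega)) h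
  have hdeg : p.natDegree ≤ m := by
    refine natDegree_sum_le_of_forall_le _ _ (fun n _ => ?_)
    exact (natDegree_C_mul_X_pow_le _ _).trans (by omega)
  have hm : p.Monic := monic_of_natDegree_le_of_coeff_eq_one m hdeg (by simpa [hA] using hcoeff 0 (by omega))
  have hdeg' : p.natDegree = m := by
    refine le_antisymm hdeg (le_natDegree_of_ne_zero ?_)
    have := hcoeff 0 (by omega)
    rw [Nat.sub_zero] at this
    rw [this, hA]; exact one_ne_zero
  have hcard : p.roots.card = m := by
    rw [← hdeg']; exact (IsAlgClosed.splits p).natDegree_eq_card_roots.symm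
  obtain ⟨l, hl⟩ : ∃ l : List ℂ, (l : Multiset ℂ) = p.roots := Quot.exists_rep p.roots
  have hlen : l.length = m := by rw [← hcard, ← hl]; rfl
  let α : Fin m → ℂ := fun i => l.get (i.cast hlen.symm)
  have hα : (univ.val.map α : Multiset ℂ) = p.roots := by
    subst hlen
    rw [← hl]
    simp only [Fin.univ_val_map]
    simp [α]
  have he : ∀ n, A n = (-1) ^ n * MvPolynomial.aeval α (MvPolynomial.esymm (Fin m) ℂ n) := by
    intro n
    rw [MvPolynomial.aeval_esymm_eq_multiset_esymm, hα]
    by_cases hn : n ≤ m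
    · rw [← hcoeff n hn, Polynomial.coeff_eq_esymm_roots_of_card (by rw [hcard, hdeg']) (by omega), hm.leadingCoeff,
        hdeg', Nat.sub_sub_self hn, one_mul]
    · rw [hA0 n (by omega), Multiset.esymm, Multiset.powersetCard_eq_empty _ (by rw [hcard]; omega)]
      simp
  refine ⟨α, conv_inj A f (fun x => - ∑ i, α i ^ x) hA (fun n => ?_)⟩
  rw [← hrec, he n]
  have hN := congrArg (MvPolynomial.aeval α) (MvPolynomial.mul_esymm_eq_sum (Fin m) ℂ n)
  simp only [map_mul, map_natCast, map_pow, map_neg, map_one, map_sum] at hN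
  rw [mul_left_comm, hN, ← mul_assoc, ← pow_add, (by rw [show n + (n + 1) = 2 * n + 1 by ring]; simp [pow_succ, pow_mul] : (-1 : ℂ) ^ (n + (n + 1)) = -1),
    neg_one_mul, ← Finset.sum_neg_distrib]
  refine Finset.sum_bij' (fun a _ => a.2) (fun x _ => (n - x, x)) ?_ ?_ ?_ ?_ ?_
  · intro a ha
    have h1 := Finset.HasAntidiagonal.mem_antidiagonal.1 (Finset.mem_filter.1 ha).1
    have h2 := (Finset.mem_filter.1 ha).2
    rw [mem_Icc]
    omega
  · intro a ha
    rw [mem_Icc] at ha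
    refine Finset.mem_filter.2 ⟨Finset.HasAntidiagonal.mem_antidiagonal.2 ?_, ?_⟩
    · show n - a + a = n
      omega
    · show n - a < n
      omega
  · intro a ha
    have h1 := Finset.HasAntidiagonal.mem_antidiagonal.1 (Finset.mem_filter.1 ha).1
    ext
    · show n - a.2 = a.1
      omega
    · rfl
  · intro a ha; rfl
  · intro a ha
    have h1 := Finset.HasAntidiagonal.mem_antidiagonal.1 (Finset.mem_filter.1 ha).1
    have : n - a.2 = a.1 := by omega
    rw [this, he a.1]
    simp only [MvPolynomial.psum, map_sum, map_pow, MvPolynomial.aeval_X]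
    ring
end ps
end LV

open Polynomial Finset Filter
open scoped Classical
set_option linter.unusedSectionVars false
namespace LV

section rh
variable {F : Type} [Field F] [Fintype F]

lemma psi_card (x : ℕ) (hx : 1 ≤ x) :
    ∑ d ∈ x.divisors, d * (Px F d).card = Fintype.card F ^ x := by
  have h := conv_inj (fun n => (Fintype.card F : ℂ) ^ n)
    (fun x => ∑ d ∈ x.divisors, ∑ P ∈ Px F d, (P.natDegree : ℂ)) (fun x => (Fintype.card F : ℂ) ^ x)
    (by simp) (fun n => ?_) x hx
  · have h2 : ∑ d ∈ x.divisors, ∑ P ∈ Px F d, (P.natDegree : ℂ) =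
        ((∑ d ∈ x.divisors, d * (Px F d).card : ℕ) : ℂ) := by
      rw [Nat.cast_sum]
      refine Finset.sum_congr rfl (fun d _ => ?_)
      rw [Finset.sum_congr rfl (fun P hP => by rw [(mem_Px.1 hP).2.1]), Finset.sum_const, nsmul_eq_mul]
      push_cast; ring
    rw [h2] at h
    exact_mod_cast h
  · have h1 := conv (F := F) (fun P => (P.natDegree : ℂ)) (fun _ => 1) n
    have h3 : ∀ k, ∑ M ∈ Mn F k, (1 : ℂ) = (Fintype.card F : ℂ) ^ k := by
      intro k; rw [Finset.sum_const, card_Mn]; simp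
    simp only [h3, mul_one, ← Finset.sum_mul] at h1
    rw [← h1, Finset.sum_congr rfl (fun G hG => rr_deg hG), Finset.sum_const, card_Mn, nsmul_eq_mul]
    rw [Finset.sum_congr rfl (g := fun _ => (Fintype.card F : ℂ) ^ n) (fun x hx => by
      rw [mem_Icc] at hx
      rw [← pow_add]; congr 1; omega), Finset.sum_const]
    simp [mul_comm]

lemma card_Px (d : ℕ) : d * (Px F d).card ≤ Fintype.card F ^ d := by
  rcases Nat.eq_zero_or_pos d with rfl | hd
  · simp
  rw [← psi_card (F := F) d hd]
  exact Finset.single_le_sum (f := fun d => d * (Px F d).card) (fun _ _ => Nat.zero_le _)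
    (Nat.mem_divisors_self d hd.ne')

variable {m : ℕ}

lemma ch_one (χ : AddChar (Additive (UU F m)) ℂ) : ch χ (1 : F[X]) = 1 := by
  rw [ch, pi_one]; exact AddChar.map_zero_eq_one χ

lemma ch_mul (χ : AddChar (Additive (UU F m)) ℂ) {f g : F[X]} (hf : f.Monic) (hg : g.Monic) :
    ch χ (f * g) = ch χ f * ch χ g := by
  rw [ch, pi_mul m hf hg, ofMul_mul, AddChar.map_add_eq_mul]; rfl

lemma sum_ch_zero (χ : AddChar (Additive (UU F m)) ℂ) (hχ : χ ≠ 0) {n : ℕ} (hn : m ≤ n) :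
    ∑ G ∈ Mn F n, ch χ G = 0 := by
  have hχ0 : ∑ u : UU F m, χ (Additive.ofMul u) = 0 := by
    have h1 := AddChar.sum_eq_ite χ
    rw [if_neg hχ] at h1
    rw [← h1]
    exact Fintype.sum_equiv Additive.ofMul _ _ (fun _ => rfl)
  rw [← Finset.sum_fiberwise_of_maps_to (g := fun f => pi m f) (t := Finset.univ)
      (fun _ _ => Finset.mem_univ _)]
  have h2 : ∀ u : UU F m, ∑ G ∈ (Mn F n).filter (fun f => pi m f = u), ch χ G =
      (Fintype.card F : ℂ) ^ (n - m) * χ (Additive.ofMul u) := by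
    intro u
    rw [Finset.sum_congr rfl (g := fun _ => χ (Additive.ofMul u)) (fun G hG => by
      rw [ch, (Finset.mem_filter.1 hG).2]), Finset.sum_const, fiber_card m hn u, nsmul_eq_mul]
    push_cast; rfl
  rw [Finset.sum_congr rfl (fun u _ => h2 u), ← Finset.mul_sum, hχ0, mul_zero]

lemma sum_ch_rec (χ : AddChar (Additive (UU F m)) ℂ) (n : ℕ) :
    (n : ℂ) * ∑ G ∈ Mn F n, ch χ G = ∑ x ∈ Icc 1 n, psi χ x * ∑ G ∈ Mn F (n - x), ch χ G := by
  have h1 := conv (F := F) (fun P => (P.natDegree : ℂ)) (ch χ) n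
  rw [Finset.sum_congr rfl (fun G hG => by rw [rr_deg hG]), ← Finset.mul_sum] at h1
  rw [h1]
  refine Finset.sum_congr rfl (fun x _ => ?_)
  rw [psi, Finset.sum_mul]
  refine Finset.sum_congr rfl (fun d _ => ?_)
  rw [Finset.sum_mul]
  refine Finset.sum_congr rfl (fun P hP => ?_)
  have hP' := mem_Px.1 hP
  rw [hP'.2.1, mul_assoc]
  congr 1
  rw [Finset.mul_sum]
  exact Finset.sum_congr rfl (fun M hM => ch_mul χ (hP'.1.pow _) (mem_Mn.1 hM).1)

theorem psi_bound (χ : AddChar (Additive (UU F m)) ℂ) (hχ : χ ≠ 0) (x : ℕ) (hx : 1 ≤ x) :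
    ‖psi χ x‖ ≤ m * Real.sqrt (Fintype.card F) ^ x := by
  set q : ℝ := (Fintype.card F : ℝ) with hq
  have hqpos : 0 < q := by rw [hq]; exact_mod_cast Fintype.card_pos
  obtain ⟨α, hα⟩ := newton_roots (fun n => ∑ G ∈ Mn F n, ch χ G) (psi χ) m
    (by simp [Mn_zero, ch_one]) (fun n hn => sum_ch_zero χ hχ hn.le) (sum_ch_rec χ)
  obtain ⟨C, y0, hC⟩ := psi_even_bound (F := F) m
  have hb := power_sum (fun i => α i ^ 2 / (q : ℂ)) C (y0 + 1) (fun y hy => ?_)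
  · have hα1 : ∀ i, ‖α i‖ ≤ Real.sqrt q := by
      intro i
      have h1 := hb i
      rw [norm_div, norm_pow, Complex.norm_real, Real.norm_of_nonneg hqpos.le, div_le_one hqpos] at h1
      exact Real.le_sqrt_of_sq_le h1
    rw [hα x hx, norm_neg]
    refine (norm_sum_le _ _).trans ?_
    calc ∑ i, ‖α i ^ x‖ ≤ ∑ i : Fin m, Real.sqrt q ^ x := by
          refine Finset.sum_le_sum (fun i _ => ?_)
          rw [norm_pow]
          exact pow_le_pow_left₀ (norm_nonneg _) (hα1 i) _
      _ = _ := by simp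
  · have h1 := hC y (by omega) χ hχ
    rw [hα (2 * y) (by omega), norm_neg] at h1
    have h2 : ∑ i, (α i ^ 2 / (q : ℂ)) ^ y = (∑ i, α i ^ (2 * y)) / (q : ℂ) ^ y := by
      rw [Finset.sum_div]
      exact Finset.sum_congr rfl (fun i _ => by rw [div_pow, pow_mul])
    rw [h2, norm_div, norm_pow, Complex.norm_real, Real.norm_of_nonneg hqpos.le, div_le_iff₀ (by positivity)]
    exact h1
end rh
end LV

open Polynomial Finset Filter
open scoped Classical
set_option linter.unusedSectionVars false
namespace LV
open UniqueFactorizationMonoid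

section lam
variable {F : Type} [Field F] [Fintype F]

lemma lam_eq (G : F[X]) : liouville G = (-1) ^ Multiset.card (normalizedFactors G) := by
  rw [liouville, normalizedFactors, Multiset.card_map]

lemma lam_mul {f g : F[X]} (hf : f ≠ 0) (hg : g ≠ 0) : liouville (f * g) = liouville f * liouville g := by
  rw [lam_eq, lam_eq, lam_eq, normalizedFactors_mul hf hg, Multiset.card_add, pow_add]

lemma lam_one : liouville (1 : F[X]) = 1 := by
  rw [lam_eq, normalizedFactors_one]; simp

lemma lam_irred {P : F[X]} (hi : Irreducible P) : liouville P = -1 := by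
  rw [lam_eq, normalizedFactors_irreducible hi]; simp

lemma lam_pow {P : F[X]} (hi : Irreducible P) (k : ℕ) : liouville (P ^ k) = (-1) ^ k := by
  induction k with
  | zero => simp [lam_one]
  | succ k ih => rw [pow_succ, lam_mul (pow_ne_zero _ hi.ne_zero) hi.ne_zero, ih, lam_irred hi, pow_succ]

lemma norm_lam (G : F[X]) : ‖(liouville G : ℂ)‖ = 1 := by
  rw [lam_eq]; simp

lemma geom_le (q D : ℕ) (hq : 2 ≤ q) : ∑ d ∈ Finset.range (D + 1), q ^ d ≤ 2 * q ^ D := by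
  induction D with
  | zero => simp
  | succ D ih =>
    rw [Finset.sum_range_succ]
    have : q ^ (D + 1) = q * q ^ D := by ring
    nlinarith [Nat.zero_le (q ^ D)]

lemma proper_bound (x : ℕ) (S : Finset ℕ) (hS : ∀ d ∈ S, d ∣ x ∧ d < x) :
    ∑ d ∈ S, d * (Px F d).card ≤ 2 * Fintype.card F ^ (x / 2) := by
  refine le_trans ?_ (geom_le (Fintype.card F) (x / 2) Fintype.one_lt_card)
  refine (Finset.sum_le_sum (fun d _ => card_Px (F := F) d)).trans ?_
  refine Finset.sum_le_sum_of_subset (fun d hd => ?_)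
  obtain ⟨⟨c, hc⟩, h2⟩ := hS d hd
  rw [Finset.mem_range]
  have : 2 ≤ c := by
    by_contra h
    have : c = 0 ∨ c = 1 := by omega
    rcases this with rfl | rfl <;> omega
  have : d * 2 ≤ x := by rw [hc]; exact Nat.mul_le_mul_left _ this
  omega

lemma lam_coef (x : ℕ) (hx : 1 ≤ x) : ∑ d ∈ x.divisors, ∑ P ∈ Px F d, (d : ℂ) * (-1) ^ (x / d) =
    - (Fintype.card F : ℂ) ^ x + (if Even x then 2 * (Fintype.card F : ℂ) ^ (x / 2) else 0) := by
  have h1 : ∀ d ∈ x.divisors, ∑ P ∈ Px F d, (d : ℂ) * (-1) ^ (x / d) =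
      -((d * (Px F d).card : ℕ) : ℂ) + if Even (x / d) then 2 * ((d * (Px F d).card : ℕ) : ℂ) else 0 := by
    intro d _
    rw [Finset.sum_const, nsmul_eq_mul]
    by_cases h : Even (x / d)
    · rw [if_pos h, h.neg_one_pow]; push_cast; ring
    · rw [if_neg h, (Nat.not_even_iff_odd.1 h).neg_one_pow]; push_cast; ring
  rw [Finset.sum_congr rfl h1, Finset.sum_add_distrib, Finset.sum_neg_distrib, ← Nat.cast_sum,
    psi_card x hx, ← Finset.sum_filter]
  push_cast
  congr 1
  by_cases h : Even x
  · rw [if_pos h]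
    obtain ⟨y, rfl⟩ := h
    have h2 : (y + y).divisors.filter (fun d => Even ((y + y) / d)) = y.divisors := by
      ext d
      simp only [Finset.mem_filter, Nat.mem_divisors]
      constructor
      · rintro ⟨⟨⟨c, hc⟩, h0⟩, he⟩
        have hd : 0 < d := Nat.pos_of_ne_zero (by rintro rfl; omega)
        rw [hc, Nat.mul_div_cancel_left _ hd] at he
        obtain ⟨e, rfl⟩ := he
        exact ⟨⟨e, by nlinarith⟩, by omega⟩
      · rintro ⟨⟨e, he⟩, h0⟩
        have hd : 0 < d := Nat.pos_of_ne_zero (by rintro rfl; omega)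
        have h3 : y + y = d * (e + e) := by rw [he]; ring
        refine ⟨⟨⟨e + e, h3⟩, by omega⟩, ?_⟩
        rw [h3, Nat.mul_div_cancel_left _ hd]
        exact ⟨e, rfl⟩
    rw [h2, show (y + y) / 2 = y by omega, ← Finset.mul_sum]
    have h4 := psi_card (F := F) y (by omega)
    have h5 : ∑ d ∈ y.divisors, (d : ℂ) * ((Px F d).card : ℂ) = (Fintype.card F : ℂ) ^ y := by
      exact_mod_cast h4
    rw [h5]
  · rw [if_neg h]
    refine Finset.sum_eq_zero (fun d hd => ?_)
    exfalso
    obtain ⟨h3, h4⟩ := Finset.mem_filter.1 hd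
    obtain ⟨c, hc⟩ := (Nat.mem_divisors.1 h3).1
    have hd : 0 < d := Nat.pos_of_ne_zero (by rintro rfl; omega)
    rw [hc, Nat.mul_div_cancel_left _ hd] at h4
    exact h (hc ▸ h4.mul_left d)

/-- closed form -/
noncomputable def gl (q : ℂ) (n : ℕ) : ℂ := if Even n then q ^ (n / 2) else - q ^ (n / 2 + 1)

lemma gl_even (q : ℂ) (k : ℕ) : gl q (2 * k) = q ^ k := by
  rw [gl, if_pos (even_two_mul k)]; congr 1; omega

lemma gl_odd (q : ℂ) (k : ℕ) : gl q (2 * k + 1) = - q ^ (k + 1) := by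
  rw [gl, if_neg (by simp)]
  congr 2; omega

lemma a_succ (q : ℂ) (g : ℕ → ℂ) (n : ℕ) : ∑ x ∈ Icc 1 (n + 1), q ^ x * g (n + 1 - x) =
    q * ∑ x ∈ Icc 1 n, q ^ x * g (n - x) + q * g n := by
  have h1 : ∀ (n : ℕ) (f : ℕ → ℂ), ∑ x ∈ Icc 1 n, f x = ∑ x ∈ Finset.range n, f (x + 1) := by
    intro n f
    rw [Finset.range_eq_Ico, Finset.sum_Ico_add' f 0 n 1]; rfl
  rw [h1, h1, Finset.sum_range_succ', Finset.mul_sum]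
  congr 1
  · refine Finset.sum_congr rfl (fun x _ => ?_)
    rw [show n + 1 - (x + 1 + 1) = n - (x + 1) by omega]; ring
  · simp

lemma b_succ (q : ℂ) (g : ℕ → ℂ) (n : ℕ) :
    ∑ x ∈ Icc 1 (n + 2), (if Even x then 2 * q ^ (x / 2) else 0) * g (n + 2 - x) =
    q * ∑ x ∈ Icc 1 n, (if Even x then 2 * q ^ (x / 2) else 0) * g (n - x) + 2 * q * g n := by
  have h1 : ∀ (n : ℕ) (f : ℕ → ℂ), ∑ x ∈ Icc 1 n, f x = ∑ x ∈ Finset.range n, f (x + 1) := by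
    intro n f
    rw [Finset.range_eq_Ico, Finset.sum_Ico_add' f 0 n 1]; rfl
  rw [h1, h1, Finset.sum_range_succ', Finset.sum_range_succ', Finset.mul_sum]
  simp only [zero_add, Nat.not_even_one, if_false, zero_mul, add_zero]
  congr 1
  · refine Finset.sum_congr rfl (fun x _ => ?_)
    rw [show n + 2 - (x + 1 + 1 + 1) = n - (x + 1) by omega, show (x + 1 + 1 + 1) / 2 = (x + 1) / 2 + 1 by omega]
    have : Even (x + 1 + 1 + 1) ↔ Even (x + 1) := by
      rw [show x + 1 + 1 + 1 = (x + 1) + 2 by ring, Nat.even_add]; simp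
    by_cases h : Even (x + 1)
    · rw [if_pos h, if_pos (this.2 h)]; ring
    · rw [if_neg h, if_neg (fun h' => h (this.1 h'))]; ring
  · norm_num

lemma a_val (q : ℂ) (k : ℕ) : ∑ x ∈ Icc 1 (2 * k), q ^ x * gl q (2 * k - x) = 0 ∧
    ∑ x ∈ Icc 1 (2 * k + 1), q ^ x * gl q (2 * k + 1 - x) = q ^ (k + 1) := by
  induction k with
  | zero => simp [gl]
  | succ k ih =>
    have h1 : ∑ x ∈ Icc 1 (2 * (k + 1)), q ^ x * gl q (2 * (k + 1) - x) = 0 := by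
      rw [show 2 * (k + 1) = (2 * k + 1) + 1 by ring, a_succ, ih.2, gl_odd]; ring
    refine ⟨h1, ?_⟩
    rw [a_succ, h1, gl_even]; ring

lemma b_val (q : ℂ) (k : ℕ) :
    ∑ x ∈ Icc 1 (2 * k), (if Even x then 2 * q ^ (x / 2) else 0) * gl q (2 * k - x) = 2 * k * q ^ k ∧
    ∑ x ∈ Icc 1 (2 * k + 1), (if Even x then 2 * q ^ (x / 2) else 0) * gl q (2 * k + 1 - x)
      = - (2 * k * q ^ (k + 1)) := by
  induction k with
  | zero => simp
  | succ k ih =>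
    constructor
    · rw [show 2 * (k + 1) = 2 * k + 2 by ring, b_succ, ih.1, gl_even]; push_cast; ring
    · rw [show 2 * (k + 1) + 1 = (2 * k + 1) + 2 by ring, b_succ, ih.2, gl_odd]; push_cast; ring

lemma gl_rec (q : ℂ) (n : ℕ) : ∑ x ∈ Icc 1 n,
    (-q ^ x + (if Even x then 2 * q ^ (x / 2) else 0)) * gl q (n - x) = n * gl q n := by
  simp only [add_mul, Finset.sum_add_distrib, neg_mul, Finset.sum_neg_distrib]
  rcases Nat.even_or_odd' n with ⟨k, rfl | rfl⟩
  · rw [(a_val q k).1, (b_val q k).1, gl_even]; push_cast; ring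
  · rw [(a_val q k).2, (b_val q k).2, gl_odd]; push_cast; ring

theorem lam_total (n : ℕ) : ∑ G ∈ Mn F n, (liouville G : ℂ) = gl (Fintype.card F : ℂ) n := by
  induction n using Nat.strong_induction_on with
  | _ n ih =>
  rcases Nat.eq_zero_or_pos n with rfl | hn
  · simp [Mn_zero, lam_one, gl]
  have h1 := conv (F := F) (fun P => (P.natDegree : ℂ)) (fun G => (liouville G : ℂ)) n
  rw [Finset.sum_congr rfl (fun G hG => by rw [rr_deg hG]), ← Finset.mul_sum] at h1
  have h2 : (n : ℂ) ≠ 0 := by exact_mod_cast hn.ne'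
  apply mul_left_cancel₀ h2
  rw [h1, ← gl_rec]
  refine Finset.sum_congr rfl (fun x hx => ?_)
  rw [mem_Icc] at hx
  rw [← lam_coef x hx.1, Finset.sum_mul, ← ih (n - x) (by omega)]
  refine Finset.sum_congr rfl (fun d _ => ?_)
  rw [Finset.sum_mul]
  refine Finset.sum_congr rfl (fun P hP => ?_)
  have hP' := mem_Px.1 hP
  rw [hP'.2.1, mul_assoc]
  congr 1
  rw [Finset.mul_sum]
  refine Finset.sum_congr rfl (fun M hM => ?_)
  rw [lam_mul (pow_ne_zero _ hP'.1.ne_zero) (mem_Mn.1 hM).1.ne_zero, lam_pow hP'.2.2]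
  push_cast; ring

theorem lam_total_bound (n : ℕ) : ‖∑ G ∈ Mn F n, (liouville G : ℂ)‖ ^ 2 ≤ (Fintype.card F : ℝ) ^ (n + 1) := by
  rw [lam_total]
  have h1 : (1 : ℝ) ≤ Fintype.card F := by exact_mod_cast Fintype.card_pos
  rcases Nat.even_or_odd' n with ⟨k, rfl | rfl⟩
  · rw [gl_even, norm_pow, Complex.norm_natCast, ← pow_mul]
    exact pow_le_pow_right₀ h1 (by omega)
  · rw [gl_odd, norm_neg, norm_pow, Complex.norm_natCast, ← pow_mul]
    exact pow_le_pow_right₀ h1 (by omega)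

end lam
end LV

open Polynomial Finset Filter
open scoped Classical
set_option linter.unusedSectionVars false
namespace LV
open UniqueFactorizationMonoid

section smooth

lemma rec_bound (u c : ℕ → ℝ) (h : ℕ) (hh : 1 ≤ h) (C0 : ℝ) (hC0 : 0 < C0)
    (ha : Real.exp (C0 / h) ≤ 16 / 15) (hu0 : ∀ n, 0 ≤ u n) (hu1 : ∀ n, u n ≤ 1)
    (hc0 : ∀ x, 1 ≤ x → 0 ≤ c x)
    (hc1 : ∀ x, 1 ≤ x → x ≤ h → c x ≤ 1) (hc2 : ∀ x, h < x → c x ≤ 2 * (3 / 4) ^ x)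
    (hrec : ∀ n : ℕ, (n : ℝ) * u n ≤ ∑ x ∈ Icc 1 n, c x * u (n - x)) (n : ℕ) :
    Real.exp (C0 / h) ^ n * u n ≤ Real.exp (C0 * (Real.exp C0 + 10)) := by
  set a := Real.exp (C0 / h) with had
  set K := Real.exp (C0 * (Real.exp C0 + 10)) with hK
  have hh' : (1 : ℝ) ≤ h := by exact_mod_cast hh
  have ha0 : 0 < a := Real.exp_pos _
  have ha1 : 1 ≤ a := Real.one_le_exp (by positivity)
  have hah : a ^ h = Real.exp C0 := by
    rw [had, ← Real.exp_nat_mul, mul_div_cancel₀ _ (by positivity)]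
  have hK0 : 0 < K := Real.exp_pos _
  induction n using Nat.strong_induction_on with
  | _ n ih =>
  by_cases hn : (n : ℝ) < h * Real.exp C0 + 10
  · have h1 : a ^ n ≤ K := by
      rw [had, ← Real.exp_nat_mul, hK]
      apply Real.exp_le_exp.2
      rw [← mul_div_assoc, div_le_iff₀ (by positivity)]
      have h2 : (n : ℝ) ≤ (Real.exp C0 + 10) * h := by nlinarith
      nlinarith
    calc a ^ n * u n ≤ a ^ n * 1 := by gcongr; exact hu1 n
      _ ≤ K := by rw [mul_one]; exact h1
  · push Not at hn
    have hnpos : (0 : ℝ) < n := by have := Real.exp_pos C0; nlinarith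
    have hterm : ∀ x ∈ Icc 1 n, a ^ n * (c x * u (n - x)) ≤
        K * ((if x ≤ h then Real.exp C0 else 0) + 2 * (4 / 5) ^ x) := by
      intro x hx
      rw [mem_Icc] at hx
      have h1 : a ^ n * (c x * u (n - x)) = (c x * a ^ x) * (a ^ (n - x) * u (n - x)) := by
        have : a ^ n = a ^ x * a ^ (n - x) := by rw [← pow_add]; congr 1; omega
        rw [this]; ring
      have h2 : c x * a ^ x ≤ (if x ≤ h then Real.exp C0 else 0) + 2 * (4 / 5) ^ x := by
        by_cases hxh : x ≤ h
        · rw [if_pos hxh]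
          have h3 : c x * a ^ x ≤ 1 * a ^ h :=
            mul_le_mul (hc1 x hx.1 hxh) (pow_le_pow_right₀ ha1 hxh) (by positivity) (by norm_num)
          rw [one_mul, hah] at h3
          have : (0 : ℝ) ≤ 2 * (4 / 5) ^ x := by positivity
          linarith
        · rw [if_neg hxh, zero_add]
          calc c x * a ^ x ≤ (2 * (3 / 4) ^ x) * (16 / 15) ^ x := by
                gcongr
                exact hc2 x (by omega)
            _ = 2 * (4 / 5) ^ x := by rw [mul_assoc, ← mul_pow]; norm_num
      rw [h1, mul_comm K]
      refine mul_le_mul h2 (ih (n - x) (by omega)) (mul_nonneg (by positivity) (hu0 _)) ?_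
      split_ifs <;> positivity
    have hs1 : ∑ x ∈ Icc 1 n, (if x ≤ h then Real.exp C0 else 0) ≤ h * Real.exp C0 := by
      rw [← Finset.sum_filter, Finset.sum_const, nsmul_eq_mul]
      gcongr
      calc ((Icc 1 n).filter (fun x => x ≤ h)).card ≤ (Icc 1 h).card := by
            refine Finset.card_le_card (fun x hx => ?_)
            simp only [Finset.mem_filter, mem_Icc] at hx ⊢
            omega
        _ = h := by simp
    have hs2 : ∑ x ∈ Icc 1 n, 2 * (4 / 5 : ℝ) ^ x ≤ 10 := by
      rw [← Finset.mul_sum]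
      have h3 : ∑ x ∈ Icc 1 n, (4 / 5 : ℝ) ^ x ≤ 5 := by
        have h4 := Summable.sum_le_tsum (Icc 1 n) (fun x _ => (by positivity : (0 : ℝ) ≤ (4 / 5) ^ x))
          (summable_geometric_of_lt_one (by norm_num) (by norm_num : (4 / 5 : ℝ) < 1))
        rw [tsum_geometric_of_lt_one (by norm_num) (by norm_num)] at h4
        norm_num at h4 ⊢
        exact h4
      linarith
    have h5 : (n : ℝ) * (a ^ n * u n) ≤ n * K := by
      calc (n : ℝ) * (a ^ n * u n) = a ^ n * (n * u n) := by ring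
        _ ≤ a ^ n * ∑ x ∈ Icc 1 n, c x * u (n - x) := by gcongr; exact hrec n
        _ = ∑ x ∈ Icc 1 n, a ^ n * (c x * u (n - x)) := Finset.mul_sum _ _ _
        _ ≤ ∑ x ∈ Icc 1 n, K * ((if x ≤ h then Real.exp C0 else 0) + 2 * (4 / 5) ^ x) :=
            Finset.sum_le_sum hterm
        _ = K * (∑ x ∈ Icc 1 n, (if x ≤ h then Real.exp C0 else 0) + ∑ x ∈ Icc 1 n, 2 * (4 / 5 : ℝ) ^ x) := by
            rw [← Finset.mul_sum, Finset.sum_add_distrib]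
        _ ≤ K * (h * Real.exp C0 + 10) := by gcongr
        _ ≤ K * n := by gcongr
        _ = n * K := mul_comm _ _
    exact le_of_mul_le_mul_left h5 hnpos

variable {F : Type} [Field F] [Fintype F]

/-- weight of large primes -/
noncomputable def wh (h : ℕ) (P : F[X]) : ℝ := if P.natDegree ≤ h then 0 else P.natDegree

lemma wh_nonneg (h : ℕ) (P : F[X]) : 0 ≤ wh h P := by rw [wh]; split_ifs <;> positivity

lemma rr_nonneg (h : ℕ) (G : F[X]) : 0 ≤ rr (wh h) G := by
  rw [rr]
  refine Multiset.sum_nonneg (fun x hx => ?_)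
  obtain ⟨P, _, rfl⟩ := Multiset.mem_map.1 hx
  exact wh_nonneg h P

/-- smooth count -/
noncomputable def sN (F : Type) [Field F] [Fintype F] (h n : ℕ) : ℝ := ∑ G ∈ Mn F n, if rr (wh h) G = 0 then (1 : ℝ) else 0

lemma sN_nonneg (h n : ℕ) : 0 ≤ sN F h n := by
  rw [sN]
  refine Finset.sum_nonneg (fun G _ => ?_)
  split_ifs <;> norm_num

lemma sN_le (h n : ℕ) : sN F h n ≤ (Fintype.card F : ℝ) ^ n := by
  calc sN F h n ≤ ∑ G ∈ Mn F n, (1 : ℝ) := by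
        refine Finset.sum_le_sum (fun G _ => ?_)
        split_ifs <;> norm_num
    _ = _ := by rw [Finset.sum_const, card_Mn]; simp

lemma sN_rec (h n : ℕ) : (n : ℝ) * sN F h n =
    ∑ x ∈ Icc 1 n, (∑ d ∈ x.divisors.filter (fun d => d ≤ h), (d * (Px F d).card : ℝ)) * sN F h (n - x) := by
  have h1 := conv (F := F) (fun P => (P.natDegree : ℝ)) (fun G => if rr (wh h) G = 0 then (1 : ℝ) else 0) n
  rw [Finset.sum_congr rfl (fun G hG => by rw [rr_deg hG]), ← Finset.mul_sum] at h1
  rw [sN, h1]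
  refine Finset.sum_congr rfl (fun x hx => ?_)
  rw [Finset.sum_filter, Finset.sum_mul]
  refine Finset.sum_congr rfl (fun d hd => ?_)
  have hd0 : 0 < d := Nat.pos_of_mem_divisors hd
  have hk : 0 < x / d := Nat.div_pos (Nat.le_of_dvd (by rw [mem_Icc] at hx; omega) (Nat.dvd_of_mem_divisors hd)) hd0
  have h2 : ∀ P ∈ Px F d, (P.natDegree : ℝ) * ∑ M ∈ Mn F (n - x),
      (if rr (wh h) (P ^ (x / d) * M) = 0 then (1 : ℝ) else 0) = (if d ≤ h then (d : ℝ) else 0) * sN F h (n - x) := by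
    intro P hP
    have hP' := mem_Px.1 hP
    have h3 : ∀ M ∈ Mn F (n - x), rr (wh h) (P ^ (x / d) * M) = ((x / d : ℕ) : ℝ) * wh h P + rr (wh h) M := by
      intro M hM
      rw [rr_mul _ (pow_ne_zero _ hP'.1.ne_zero) (mem_Mn.1 hM).1.ne_zero, rr_pow _ hP'.1.ne_zero,
        rr_irred _ hP'.1 hP'.2.2]
    rw [hP'.2.1]
    by_cases hdh : d ≤ h
    · rw [if_pos hdh, sN]
      congr 1
      refine Finset.sum_congr rfl (fun M hM => ?_)
      rw [h3 M hM, wh, hP'.2.1, if_pos hdh, mul_zero, zero_add]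
    · rw [if_neg hdh, zero_mul, Finset.sum_eq_zero, mul_zero]
      intro M hM
      rw [if_neg]
      rw [h3 M hM, wh, hP'.2.1, if_neg hdh]
      have := rr_nonneg h M
      have h4 : (0 : ℝ) < ((x / d : ℕ) : ℝ) * d := by
        have : (0 : ℝ) < (x / d : ℕ) := by exact_mod_cast hk
        have : (0 : ℝ) < d := by exact_mod_cast hd0
        positivity
      linarith
  rw [Finset.sum_congr rfl h2, Finset.sum_const, nsmul_eq_mul]
  split_ifs <;> ring

lemma pow_half_le (q x : ℕ) (hq : 2 ≤ q) : (q : ℝ) ^ (x / 2) ≤ (3 / 4) ^ x * (q : ℝ) ^ x := by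
  set j := x - x / 2 with hj
  have hq' : (2 : ℝ) ≤ q := by exact_mod_cast hq
  have h1 : (q : ℝ) ^ x = (q : ℝ) ^ (x / 2) * (q : ℝ) ^ j := by rw [← pow_add]; congr 1; omega
  have h2 : (1 : ℝ) ≤ (3 / 4) ^ x * (q : ℝ) ^ j := by
    have h3 : (3 / 4 : ℝ) ^ (2 * j) ≤ (3 / 4) ^ x :=
      pow_le_pow_of_le_one (by norm_num) (by norm_num) (by omega)
    calc (1 : ℝ) ≤ (9 / 8) ^ j := one_le_pow₀ (by norm_num)
      _ = (3 / 4) ^ (2 * j) * 2 ^ j := by rw [pow_mul, ← mul_pow]; norm_num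
      _ ≤ (3 / 4) ^ x * (q : ℝ) ^ j := by gcongr
  rw [h1]
  have : (0 : ℝ) ≤ (q : ℝ) ^ (x / 2) := by positivity
  nlinarith

theorem smooth_bound (F : Type) [Field F] [Fintype F] (C0 : ℝ) (hC0 : 0 < C0) : ∃ K > 0, ∃ h0 : ℕ, ∀ h, h0 ≤ h → ∀ n : ℕ,
    sN F h n ≤ K * (Fintype.card F : ℝ) ^ n * Real.exp (- (C0 * n / h)) := by
  have h1 : Tendsto (fun h : ℕ => Real.exp (C0 / h)) atTop (nhds (Real.exp 0)) :=
    (Real.continuous_exp.tendsto 0).comp (tendsto_const_div_atTop_nhds_zero_nat C0)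
  have h2 := h1.eventually (gt_mem_nhds (show Real.exp 0 < 16 / 15 by rw [Real.exp_zero]; norm_num))
  obtain ⟨h0, hh0⟩ := eventually_atTop.1 h2
  refine ⟨Real.exp (C0 * (Real.exp C0 + 10)), Real.exp_pos _, h0 + 1, fun h hh n => ?_⟩
  set q : ℝ := (Fintype.card F : ℝ) with hq
  have hq2 : 2 ≤ Fintype.card F := Fintype.one_lt_card
  have hq0 : 0 < q := by rw [hq]; exact_mod_cast Fintype.card_pos
  have hsum : ∀ x : ℕ, 1 ≤ x → ∑ d ∈ x.divisors.filter (fun d => d ≤ h), ((d : ℝ) * (Px F d).card) ≤ q ^ x := by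
    intro x hx
    have h3 := psi_card (F := F) x hx
    have h4 : ∑ d ∈ x.divisors, ((d : ℝ) * (Px F d).card) = q ^ x := by rw [hq]; exact_mod_cast h3
    rw [← h4]
    exact Finset.sum_le_sum_of_subset_of_nonneg (Finset.filter_subset _ _) (fun _ _ _ => by positivity)
  have hb := rec_bound (fun n => sN F h n / q ^ n)
    (fun x : ℕ => (∑ d ∈ x.divisors.filter (fun d => d ≤ h), ((d : ℝ) * (Px F d).card)) / q ^ x) h (by omega) C0 hC0
    (hh0 h (by omega)).le (fun n => div_nonneg (sN_nonneg h n) (by positivity))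
    (fun n => (div_le_one (by positivity)).2 (sN_le h n))
    (fun x _ => div_nonneg (Finset.sum_nonneg (fun _ _ => by positivity)) (by positivity))
    (fun x hx _ => (div_le_one (by positivity)).2 (hsum x hx)) (fun x hx => ?_) (fun n => ?_) n
  · have h3 : Real.exp (- (C0 * n / h)) = (Real.exp (C0 / h) ^ n)⁻¹ := by
      rw [Real.exp_neg, ← Real.exp_nat_mul]; congr 2; ring
    have hE : 0 < Real.exp (C0 / h) ^ n := by positivity
    rw [h3, ← div_eq_mul_inv, le_div_iff₀ hE]
    have hb' : Real.exp (C0 / h) ^ n * sN F h n / q ^ n ≤ Real.exp (C0 * (Real.exp C0 + 10)) := by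
      rw [mul_div_assoc]; exact hb
    rw [div_le_iff₀ (by positivity)] at hb'
    linarith
  · rw [div_le_iff₀ (by positivity)]
    have h3 := proper_bound (F := F) x (x.divisors.filter (fun d => d ≤ h)) (fun d hd => by
      obtain ⟨h4, h5⟩ := Finset.mem_filter.1 hd
      exact ⟨Nat.dvd_of_mem_divisors h4, by omega⟩)
    have h4 : ∑ d ∈ x.divisors.filter (fun d => d ≤ h), ((d : ℝ) * (Px F d).card) ≤ 2 * q ^ (x / 2) := by
      rw [hq]; exact_mod_cast h3
    have h5 := pow_half_le (Fintype.card F) x hq2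
    rw [← hq] at h5
    linarith
  · rw [← mul_div_assoc, sN_rec, Finset.sum_div]
    refine le_of_eq (Finset.sum_congr rfl (fun x hx => ?_))
    rw [mem_Icc] at hx
    have : q ^ n = q ^ x * q ^ (n - x) := by rw [← pow_add]; congr 1; omega
    rw [this]
    exact mul_div_mul_comm _ _ _ _
end smooth
end LV

open Polynomial Finset Filter
open scoped Classical
set_option linter.unusedSectionVars false
namespace LV
open UniqueFactorizationMonoid

section pars
variable {F : Type} [Field F] [Fintype F] {m : ℕ}

lemma parseval_gen {α : Type} [AddCommGroup α] [Fintype α] (B : α → ℂ) :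
    ∑ χ : AddChar α ℂ, ‖∑ u, B u * χ u‖ ^ 2 =
      (Fintype.card α : ℝ) * ∑ u, ‖B u‖ ^ 2 := by
  have key : ((∑ χ : AddChar α ℂ, ‖∑ u, B u * χ u‖ ^ 2 : ℝ) : ℂ) =
      (((Fintype.card α : ℝ) * ∑ u, ‖B u‖ ^ 2 : ℝ) : ℂ) := by
    push_cast
    have h1 : ∀ χ : AddChar α ℂ, ((‖∑ u, B u * χ u‖ : ℂ)) ^ 2 =
        ∑ u, ∑ v, B u * (starRingEnd ℂ) (B v) * χ (u - v) := by
      intro χ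
      rw [← Complex.mul_conj', map_sum, Finset.sum_mul_sum]
      refine Finset.sum_congr rfl (fun u _ => Finset.sum_congr rfl (fun v _ => ?_))
      rw [map_mul, sub_eq_add_neg, AddChar.map_add_eq_mul, AddChar.map_neg_eq_conj]
      ring
    rw [Finset.sum_congr rfl (fun χ _ => h1 χ), Finset.sum_comm, Finset.mul_sum]
    refine Finset.sum_congr rfl (fun u _ => ?_)
    rw [Finset.sum_comm]
    simp only [← Finset.mul_sum, AddChar.sum_apply_eq_ite, sub_eq_zero]
    rw [Finset.sum_eq_single u]
    · rw [if_pos rfl, Complex.mul_conj', mul_comm]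
    · intro v _ hv
      rw [if_neg (fun h => hv h.symm), mul_zero]
    · intro h; exact absurd (Finset.mem_univ _) h
  exact_mod_cast key

noncomputable instance instFintypeDual : Fintype (AddChar (Additive (UU F m)) ℂ) :=
  AddChar.instFintype (Additive (UU F m)) ℂ

lemma parseval (B : UU F m → ℂ) :
    ∑ χ : AddChar (Additive (UU F m)) ℂ, ‖∑ u, B u * χ (Additive.ofMul u)‖ ^ 2 =
      (Fintype.card F : ℝ) ^ m * ∑ u, ‖B u‖ ^ 2 := by
  have h1 := parseval_gen (α := Additive (UU F m)) (fun u => B u.toMul)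
  have h2 : Fintype.card (Additive (UU F m)) = Fintype.card F ^ m := by
    rw [← card_UU (F := F) m]; exact Fintype.card_congr Additive.toMul
  rw [h2] at h1
  push_cast at h1
  have e3 : ∑ u : Additive (UU F m), ‖B u.toMul‖ ^ 2 = ∑ u : UU F m, ‖B u‖ ^ 2 :=
    (Equiv.sum_comp Additive.ofMul (fun u : Additive (UU F m) => ‖B u.toMul‖ ^ 2)).symm
  rw [e3] at h1
  refine Eq.trans (Finset.sum_congr rfl (fun χ _ => ?_)) h1
  congr 2
  exact Equiv.sum_comp Additive.ofMul (fun u : Additive (UU F m) => B u.toMul * χ u)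

lemma sum_ch_fiber (b : F[X] → ℂ) (n : ℕ) (χ : AddChar (Additive (UU F m)) ℂ) :
    ∑ G ∈ Mn F n, b G * ch χ G = ∑ u : UU F m,
      (∑ G ∈ (Mn F n).filter (fun G => pi m G = u), b G) * χ (Additive.ofMul u) := by
  rw [← Finset.sum_fiberwise_of_maps_to (g := fun f => pi m f) (t := Finset.univ)
      (fun _ _ => Finset.mem_univ _)]
  refine Finset.sum_congr rfl (fun u _ => ?_)
  rw [Finset.sum_mul]
  refine Finset.sum_congr rfl (fun G hG => ?_)
  rw [ch, (Finset.mem_filter.1 hG).2]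

lemma parseval_poly (b : F[X] → ℂ) (n : ℕ) :
    ∑ χ : AddChar (Additive (UU F m)) ℂ, ‖∑ G ∈ Mn F n, b G * ch χ G‖ ^ 2 =
      (Fintype.card F : ℝ) ^ m * ∑ u : UU F m, ‖∑ G ∈ (Mn F n).filter (fun G => pi m G = u), b G‖ ^ 2 := by
  rw [← parseval]
  exact Finset.sum_congr rfl (fun χ _ => by rw [sum_ch_fiber])

lemma norm_sum_sq_le (s : Finset F[X]) (b : F[X] → ℂ) : ‖∑ G ∈ s, b G‖ ^ 2 ≤ s.card * ∑ G ∈ s, ‖b G‖ ^ 2 := by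
  calc ‖∑ G ∈ s, b G‖ ^ 2 ≤ (∑ G ∈ s, ‖b G‖) ^ 2 := by gcongr; exact norm_sum_le _ _
    _ ≤ _ := sq_sum_le_card_mul_sum_sq

lemma parseval_le (b : F[X] → ℂ) (n k : ℕ) (hk : ∀ u : UU F m, ((Mn F n).filter (fun G => pi m G = u)).card ≤ k) :
    ∑ χ : AddChar (Additive (UU F m)) ℂ, ‖∑ G ∈ Mn F n, b G * ch χ G‖ ^ 2 ≤
      (Fintype.card F : ℝ) ^ m * (k * ∑ G ∈ Mn F n, ‖b G‖ ^ 2) := by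
  rw [parseval_poly]
  gcongr
  rw [← Finset.sum_fiberwise_of_maps_to (s := Mn F n) (g := fun f => pi m f) (t := Finset.univ)
      (fun _ _ => Finset.mem_univ _), Finset.mul_sum]
  refine Finset.sum_le_sum (fun u _ => (norm_sum_sq_le _ _).trans ?_)
  gcongr
  exact hk u

lemma parseval_inj (b : F[X] → ℂ) (n : ℕ) (hn : n ≤ m) :
    ∑ χ : AddChar (Additive (UU F m)) ℂ, ‖∑ G ∈ Mn F n, b G * ch χ G‖ ^ 2 ≤
      (Fintype.card F : ℝ) ^ m * ∑ G ∈ Mn F n, ‖b G‖ ^ 2 := by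
  have h := parseval_le (m := m) b n 1 (fun u => by
    rw [Finset.card_le_one]
    intro f hf g hg
    obtain ⟨hf1, hf2⟩ := Finset.mem_filter.1 hf
    obtain ⟨hg1, hg2⟩ := Finset.mem_filter.1 hg
    exact pi_inj_of_le m hn hf1 hg1 (hf2.trans hg2.symm))
  simpa using h

/-- variance through characters -/
lemma variance_eq (h N : ℕ) (hN : N = m + (h + 1)) :
    ∑ G₀ ∈ Mn F N, ‖∑ G ∈ Ih h G₀, (liouville G : ℂ)‖ ^ 2 * (Fintype.card F : ℝ) ^ m =
      (Fintype.card F : ℝ) ^ (h + 1) *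
        ∑ χ : AddChar (Additive (UU F m)) ℂ, ‖∑ G ∈ Mn F N, (liouville G : ℂ) * ch χ G‖ ^ 2 := by
  rw [parseval_poly, ← Finset.sum_fiberwise_of_maps_to (s := Mn F N) (g := fun f => pi m f) (t := Finset.univ)
      (fun _ _ => Finset.mem_univ _), Finset.mul_sum, Finset.mul_sum]
  refine Finset.sum_congr rfl (fun u _ => ?_)
  have h1 : ∀ G₀ ∈ (Mn F N).filter (fun f => pi m f = u),
      ‖∑ G ∈ Ih h G₀, (liouville G : ℂ)‖ ^ 2 * (Fintype.card F : ℝ) ^ m =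
      ‖∑ G ∈ (Mn F N).filter (fun G => pi m G = u), (liouville G : ℂ)‖ ^ 2 * (Fintype.card F : ℝ) ^ m := by
    intro G₀ hG
    obtain ⟨h2, h3⟩ := Finset.mem_filter.1 hG
    rw [← fiber_eq m hN h2, h3]
  rw [Finset.sum_congr rfl h1, Finset.sum_const, fiber_card m (by omega) u, nsmul_eq_mul,
    show N - m = h + 1 by omega]
  push_cast; ring

/-- the large prime factor sum -/
noncomputable def Ps (h : ℕ) (χ : AddChar (Additive (UU F m)) ℂ) (x : ℕ) : ℂ :=
  ∑ d ∈ x.divisors.filter (fun d => h < d), ∑ P ∈ Px F d, (d : ℂ) * ((-1) ^ (x / d) * ch χ (P ^ (x / d)))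

lemma Ps_bound (h : ℕ) (χ : AddChar (Additive (UU F m)) ℂ) (hχ : χ ≠ 0) (x : ℕ) (hx : h < x) :
    ‖Ps h χ x‖ ≤ (m + 4) * Real.sqrt (Fintype.card F) ^ x := by
  set q : ℝ := (Fintype.card F : ℝ) with hq
  have hq1 : 1 ≤ q := by rw [hq]; exact_mod_cast Fintype.card_pos
  have hq1' : 1 ≤ Real.sqrt q := Real.one_le_sqrt.2 hq1
  have h1 : ‖Ps h χ x + psi χ x‖ ≤ 4 * Real.sqrt q ^ x := by
    have h2 : Ps h χ x + psi χ x = ∑ d ∈ x.divisors.filter (fun d => d < x), ∑ P ∈ Px F d,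
        (d : ℂ) * (((if h < d then (-1) ^ (x / d) else 0) + 1) * ch χ (P ^ (x / d))) := by
      rw [Ps, psi, Finset.sum_filter, ← Finset.sum_add_distrib, Finset.sum_filter]
      refine Finset.sum_congr rfl (fun d hd => ?_)
      by_cases hdx : d < x
      · rw [if_pos hdx]
        by_cases hdh : h < d
        · rw [if_pos hdh, if_pos hdh, ← Finset.sum_add_distrib]
          exact Finset.sum_congr rfl (fun P _ => by ring)
        · rw [if_neg hdh, if_neg hdh, zero_add]
          exact Finset.sum_congr rfl (fun P _ => by ring)
      · have : d = x := le_antisymm (Nat.divisor_le hd) (by omega)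
        subst this
        rw [if_pos hx, if_neg hdx, ← Finset.sum_add_distrib]
        refine Finset.sum_eq_zero (fun P _ => ?_)
        rw [Nat.div_self (by omega)]; ring
    have h3 : ‖Ps h χ x + psi χ x‖ ≤ ∑ d ∈ x.divisors.filter (fun d => d < x), 2 * ((d * (Px F d).card : ℕ) : ℝ) := by
      rw [h2]
      refine (norm_sum_le _ _).trans (Finset.sum_le_sum (fun d _ => (norm_sum_le _ _).trans ?_))
      calc _ ≤ ∑ P ∈ Px F d, (d : ℝ) * 2 := by
            refine Finset.sum_le_sum (fun P _ => ?_)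
            rw [norm_mul, norm_mul, norm_ch, mul_one, Complex.norm_natCast]
            gcongr
            refine (norm_add_le _ _).trans ?_
            split_ifs <;> simp <;> norm_num
        _ = _ := by rw [Finset.sum_const, nsmul_eq_mul]; push_cast; ring
    have h4 := proper_bound (F := F) x (x.divisors.filter (fun d => d < x)) (fun d hd => by
      obtain ⟨h4, h5⟩ := Finset.mem_filter.1 hd
      exact ⟨Nat.dvd_of_mem_divisors h4, h5⟩)
    have h5 : ∑ d ∈ x.divisors.filter (fun d => d < x), ((d * (Px F d).card : ℕ) : ℝ) ≤ 2 * q ^ (x / 2) := by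
      rw [hq]; exact_mod_cast h4
    have h6 : q ^ (x / 2) ≤ Real.sqrt q ^ x := by
      have : q ^ (x / 2) = Real.sqrt q ^ (2 * (x / 2)) := by
        rw [pow_mul, Real.sq_sqrt (by linarith)]
      rw [this]
      exact pow_le_pow_right₀ hq1' (by omega)
    rw [← Finset.mul_sum] at h3
    linarith
  have h7 := psi_bound χ hχ x (by omega)
  have h8 := norm_sub_le (Ps h χ x + psi χ x) (psi χ x)
  rw [add_sub_cancel_right] at h8
  rw [← hq] at h7
  linarith

lemma rr_cast (w : F[X] → ℝ) (G : F[X]) : rr (fun P => (w P : ℂ)) G = ((rr w G : ℝ) : ℂ) := by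
  rw [rr, rr, ← Complex.ofRealHom_eq_coe, map_multiset_sum, Multiset.map_map]
  rfl

lemma ns_eq (h N : ℕ) (χ : AddChar (Additive (UU F m)) ℂ) :
    ∑ G ∈ Mn F N, (if rr (wh h) G = 0 then 0 else (liouville G : ℂ)) * ch χ G =
      ∑ x ∈ Ioc h N, Ps h χ x * ∑ M ∈ Mn F (N - x), ((liouville M : ℂ) / ((x + rr (wh h) M : ℝ) : ℂ)) * ch χ M := by
  have h1 := conv (F := F) (fun P => (wh h P : ℂ))
    (fun G => (liouville G : ℂ) * ch χ G / ((rr (wh h) G : ℝ) : ℂ)) N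
  have h2 : ∑ G ∈ Mn F N, (if rr (wh h) G = 0 then 0 else (liouville G : ℂ)) * ch χ G =
      ∑ G ∈ Mn F N, rr (fun P => (wh h P : ℂ)) G *
        ((liouville G : ℂ) * ch χ G / ((rr (wh h) G : ℝ) : ℂ)) := by
    refine Finset.sum_congr rfl (fun G _ => ?_)
    rw [rr_cast]
    split_ifs with h0
    · rw [h0]; simp
    · have : ((rr (wh h) G : ℝ) : ℂ) ≠ 0 := by exact_mod_cast h0
      rw [mul_div_cancel₀ _ this]
  rw [h2, h1]
  have hsub : Ioc h N ⊆ Icc 1 N := by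
    intro x; rw [mem_Ioc, mem_Icc]; omega
  rw [← Finset.sum_subset hsub]
  · refine Finset.sum_congr rfl (fun x hx => ?_)
    rw [mem_Ioc] at hx
    rw [Ps, Finset.sum_filter, Finset.sum_mul]
    refine Finset.sum_congr rfl (fun d hd => ?_)
    by_cases hdh : h < d
    · rw [if_pos hdh, Finset.sum_mul]
      refine Finset.sum_congr rfl (fun P hP => ?_)
      have hP' := mem_Px.1 hP
      rw [wh, hP'.2.1, if_neg (by omega)]
      push_cast
      rw [mul_assoc]
      congr 1
      rw [Finset.mul_sum]
      refine Finset.sum_congr rfl (fun M hM => ?_)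
      have hM' := mem_Mn.1 hM
      have h3 : rr (wh h) (P ^ (x / d) * M) = x + rr (wh h) M := by
        rw [rr_mul _ (pow_ne_zero _ hP'.1.ne_zero) hM'.1.ne_zero, rr_pow _ hP'.1.ne_zero,
          rr_irred _ hP'.1 hP'.2.2, wh, hP'.2.1, if_neg (by omega), ← Nat.cast_mul,
          Nat.div_mul_cancel (Nat.dvd_of_mem_divisors hd)]
      rw [h3, lam_mul (pow_ne_zero _ hP'.1.ne_zero) hM'.1.ne_zero, lam_pow hP'.2.2,
        ch_mul χ (hP'.1.pow _) hM'.1]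
      push_cast; ring
    · rw [if_neg hdh, zero_mul]
      refine Finset.sum_eq_zero (fun P hP => ?_)
      rw [wh, (mem_Px.1 hP).2.1, if_pos (by omega)]; simp
  · intro x hx hx'
    rw [mem_Icc] at hx
    rw [mem_Ioc] at hx'
    refine Finset.sum_eq_zero (fun d hd => Finset.sum_eq_zero (fun P hP => ?_))
    have := Nat.divisor_le hd
    rw [wh, (mem_Px.1 hP).2.1, if_pos (by omega)]; simp

lemma ns_bound (h N : ℕ) (hh : 1 ≤ h) (hN : N = m + (h + 1)) :
    ∑ χ ∈ (univ : Finset (AddChar (Additive (UU F m)) ℂ)).filter (fun χ => χ ≠ 0),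
      ‖∑ G ∈ Mn F N, (if rr (wh h) G = 0 then 0 else (liouville G : ℂ)) * ch χ G‖ ^ 2 ≤
    (Fintype.card F : ℝ) ^ m * ((N : ℝ) ^ 2 * (m + 4) ^ 2 / (h : ℝ) ^ 2 * (Fintype.card F : ℝ) ^ N) := by
  set q : ℝ := (Fintype.card F : ℝ) with hq
  have hq1 : 1 ≤ q := by rw [hq]; exact_mod_cast Fintype.card_pos
  have hh' : (0 : ℝ) < h := by exact_mod_cast hh
  let D : AddChar (Additive (UU F m)) ℂ → ℕ → ℂ := fun χ x =>
    ∑ M ∈ Mn F (N - x), ((liouville M : ℂ) / ((x + rr (wh h) M : ℝ) : ℂ)) * ch χ M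
  have h1 : ∀ χ ∈ (univ : Finset (AddChar (Additive (UU F m)) ℂ)).filter (fun χ => χ ≠ 0),
      ‖∑ G ∈ Mn F N, (if rr (wh h) G = 0 then 0 else (liouville G : ℂ)) * ch χ G‖ ^ 2 ≤
      (N : ℝ) * ∑ x ∈ Ioc h N, ((m + 4) ^ 2 * q ^ x) * ‖D χ x‖ ^ 2 := by
    intro χ hχ
    rw [ns_eq]
    calc _ ≤ (∑ x ∈ Ioc h N, ‖Ps h χ x * D χ x‖) ^ 2 := by gcongr; exact norm_sum_le _ _
      _ ≤ (Ioc h N).card * ∑ x ∈ Ioc h N, ‖Ps h χ x * D χ x‖ ^ 2 := sq_sum_le_card_mul_sum_sq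
      _ ≤ _ := by
        gcongr with x hx
        · rw [Nat.card_Ioc]; omega
        · rw [norm_mul, mul_pow]
          gcongr
          have h2 := Ps_bound h χ (Finset.mem_filter.1 hχ).2 x (mem_Ioc.1 hx).1
          calc ‖Ps h χ x‖ ^ 2 ≤ ((m + 4) * Real.sqrt q ^ x) ^ 2 := by gcongr
            _ = _ := by rw [mul_pow, ← pow_mul, mul_comm x 2, pow_mul, Real.sq_sqrt (by linarith)]
  have h3 : ∀ x ∈ Ioc h N, ∑ χ : AddChar (Additive (UU F m)) ℂ, ‖D χ x‖ ^ 2 ≤ q ^ m * (q ^ (N - x) / h ^ 2) := by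
    intro x hx
    rw [mem_Ioc] at hx
    refine (parseval_inj (m := m) _ (N - x) (by omega)).trans ?_
    gcongr
    calc _ ≤ ∑ M ∈ Mn F (N - x), 1 / (h : ℝ) ^ 2 := by
          refine Finset.sum_le_sum (fun M _ => ?_)
          have h4 := rr_nonneg h M
          have h5 : (h : ℝ) ≤ x := by exact_mod_cast hx.1.le
          rw [norm_div, norm_lam, Complex.norm_real, Real.norm_of_nonneg (by positivity), div_pow, one_pow]
          gcongr
          linarith
      _ = _ := by rw [Finset.sum_const, card_Mn, nsmul_eq_mul]; push_cast; ring
  calc _ ≤ ∑ χ ∈ (univ : Finset (AddChar (Additive (UU F m)) ℂ)).filter (fun χ => χ ≠ 0),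
        (N : ℝ) * ∑ x ∈ Ioc h N, ((m + 4) ^ 2 * q ^ x) * ‖D χ x‖ ^ 2 := Finset.sum_le_sum h1
    _ ≤ ∑ χ : AddChar (Additive (UU F m)) ℂ, (N : ℝ) * ∑ x ∈ Ioc h N, ((m + 4) ^ 2 * q ^ x) * ‖D χ x‖ ^ 2 := by
        refine Finset.sum_le_sum_of_subset_of_nonneg (Finset.filter_subset _ _) (fun _ _ _ => ?_)
        exact mul_nonneg (by positivity) (Finset.sum_nonneg (fun _ _ => by positivity))
    _ = (N : ℝ) * ∑ x ∈ Ioc h N, ((m + 4) ^ 2 * q ^ x) * ∑ χ : AddChar (Additive (UU F m)) ℂ, ‖D χ x‖ ^ 2 := by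
        rw [← Finset.mul_sum, Finset.sum_comm]
        simp only [← Finset.mul_sum]
    _ ≤ (N : ℝ) * ∑ x ∈ Ioc h N, ((m + 4) ^ 2 * q ^ x) * (q ^ m * (q ^ (N - x) / h ^ 2)) := by
        gcongr with x hx
        exact h3 x hx
    _ = (N : ℝ) * ∑ x ∈ Ioc h N, (m + 4) ^ 2 * q ^ m * (q ^ N / h ^ 2) := by
        congr 1
        refine Finset.sum_congr rfl (fun x hx => ?_)
        rw [mem_Ioc] at hx
        have : q ^ N = q ^ x * q ^ (N - x) := by rw [← pow_add]; congr 1; omega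
        rw [this]; ring
    _ = (N : ℝ) * ((Ioc h N).card * ((m + 4) ^ 2 * q ^ m * (q ^ N / h ^ 2))) := by
        rw [Finset.sum_const, nsmul_eq_mul]
    _ ≤ (N : ℝ) * (N * ((m + 4) ^ 2 * q ^ m * (q ^ N / h ^ 2))) := by
        gcongr
        rw [Nat.card_Ioc]; omega
    _ = _ := by ring

lemma sm_bound (h N : ℕ) (hN : N = m + (h + 1)) :
    ∑ χ : AddChar (Additive (UU F m)) ℂ,
      ‖∑ G ∈ Mn F N, (if rr (wh h) G = 0 then (liouville G : ℂ) else 0) * ch χ G‖ ^ 2 ≤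
    (Fintype.card F : ℝ) ^ m * ((Fintype.card F : ℝ) ^ (h + 1) * sN F h N) := by
  refine (parseval_le (m := m) _ N (Fintype.card F ^ (h + 1)) (fun u => ?_)).trans (le_of_eq ?_)
  · rw [fiber_card m (by omega) u, show N - m = h + 1 by omega]
  · push_cast
    congr 2
    rw [sN]
    refine Finset.sum_congr rfl (fun G _ => ?_)
    split_ifs
    · rw [norm_lam]; norm_num
    · simp

theorem main_bound (h N : ℕ) (hh : 1 ≤ h) (hN : N = m + (h + 1)) :
    (1 / (Fintype.card F : ℝ) ^ N) * ∑ G₀ ∈ Mn F N, ‖∑ G ∈ Ih h G₀, (liouville G : ℂ)‖ ^ 2 ≤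
      (Fintype.card F : ℝ) ^ (h + 1) * ((Fintype.card F : ℝ) / (Fintype.card F : ℝ) ^ m +
        2 * ((N : ℝ) ^ 2 * (m + 4) ^ 2 / (h : ℝ) ^ 2) +
        2 * ((Fintype.card F : ℝ) ^ (h + 1) * (sN F h N / (Fintype.card F : ℝ) ^ N))) := by
  have hv := variance_eq (F := F) (m := m) h N hN
  set q : ℝ := (Fintype.card F : ℝ) with hq
  have hq1 : 1 ≤ q := by rw [hq]; exact_mod_cast Fintype.card_pos
  set S : AddChar (Additive (UU F m)) ℂ → ℂ := fun χ => ∑ G ∈ Mn F N, (liouville G : ℂ) * ch χ G with hS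
  set S1 : AddChar (Additive (UU F m)) ℂ → ℂ := fun χ =>
    ∑ G ∈ Mn F N, (if rr (wh h) G = 0 then 0 else (liouville G : ℂ)) * ch χ G with hS1
  set S2 : AddChar (Additive (UU F m)) ℂ → ℂ := fun χ =>
    ∑ G ∈ Mn F N, (if rr (wh h) G = 0 then (liouville G : ℂ) else 0) * ch χ G with hS2
  have hsplit : ∀ χ, S χ = S1 χ + S2 χ := by
    intro χ
    rw [hS, hS1, hS2]
    simp only
    rw [← Finset.sum_add_distrib]
    refine Finset.sum_congr rfl (fun G _ => ?_)
    split_ifs <;> ring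
  have hsq : ∀ χ, ‖S χ‖ ^ 2 ≤ 2 * ‖S1 χ‖ ^ 2 + 2 * ‖S2 χ‖ ^ 2 := by
    intro χ
    have h1 := norm_add_le (S1 χ) (S2 χ)
    rw [← hsplit] at h1
    have h2 := norm_nonneg (S χ)
    nlinarith [sq_nonneg (‖S1 χ‖ - ‖S2 χ‖)]
  have h0 : ‖S 0‖ ^ 2 ≤ q ^ (N + 1) := by
    have h1 : S 0 = ∑ G ∈ Mn F N, (liouville G : ℂ) := by
      rw [hS]
      refine Finset.sum_congr rfl (fun G _ => ?_)
      rw [ch, AddChar.zero_apply, mul_one]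
    rw [h1]
    exact lam_total_bound N
  have hn := ns_bound (F := F) (m := m) h N hh hN
  have hs := sm_bound (F := F) (m := m) h N hN
  rw [← hq] at hn hs
  have htot : ∑ χ, ‖S χ‖ ^ 2 ≤ q ^ (N + 1) +
      2 * (q ^ m * ((N : ℝ) ^ 2 * (m + 4) ^ 2 / (h : ℝ) ^ 2 * q ^ N)) + 2 * (q ^ m * (q ^ (h + 1) * sN F h N)) := by
    have h1 : ∑ χ, ‖S χ‖ ^ 2 = ‖S 0‖ ^ 2 + ∑ χ ∈ univ.filter (fun χ => χ ≠ 0), ‖S χ‖ ^ 2 := by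
      rw [Finset.filter_ne' univ 0]
      exact (Finset.add_sum_erase univ (fun χ => ‖S χ‖ ^ 2) (Finset.mem_univ 0)).symm
    have h2 : ∑ χ ∈ univ.filter (fun χ => χ ≠ 0), ‖S χ‖ ^ 2 ≤
        2 * ∑ χ ∈ univ.filter (fun χ => χ ≠ 0), ‖S1 χ‖ ^ 2 + 2 * ∑ χ, ‖S2 χ‖ ^ 2 := by
      have h3 : ∑ χ ∈ univ.filter (fun χ => χ ≠ 0), ‖S2 χ‖ ^ 2 ≤ ∑ χ, ‖S2 χ‖ ^ 2 :=
        Finset.sum_le_sum_of_subset_of_nonneg (Finset.filter_subset _ _) (fun _ _ _ => by positivity)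
      have h4 := Finset.sum_le_sum (s := univ.filter (fun χ => χ ≠ 0)) (fun χ _ => hsq χ)
      rw [Finset.sum_add_distrib, ← Finset.mul_sum, ← Finset.mul_sum] at h4
      linarith
    rw [h1]
    linarith
  rw [← Finset.sum_mul] at hv
  have hqm : 0 < q ^ m := by positivity
  have hqN : 0 < q ^ N := by positivity
  have hV := eq_div_of_mul_eq hqm.ne' hv
  rw [hV]
  calc _ ≤ 1 / q ^ N * (q ^ (h + 1) * (q ^ (N + 1) +
      2 * (q ^ m * ((N : ℝ) ^ 2 * (m + 4) ^ 2 / (h : ℝ) ^ 2 * q ^ N)) + 2 * (q ^ m * (q ^ (h + 1) * sN F h N))) / q ^ m) := by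
        gcongr
    _ = _ := by
      rw [pow_succ q N]
      field_simp
end pars
end LV

theorem liouville_variance_short_intervals (Fq : Type) [Field Fq] [Fintype Fq]
    (h : ℕ → ℕ) (A : ℝ) (hA : 0 < A) (hbd : ∀ N : ℕ, (h N : ℝ) ≤ A * Real.sqrt N)
    (hinf : Filter.Tendsto h Filter.atTop Filter.atTop) :
    ∃ C > 0, ∀ᶠ N : ℕ in Filter.atTop,
      (1 / (Fintype.card Fq : ℝ) ^ N) * ∑ G₀ ∈ Mn Fq N, ‖∑ G ∈ Ih (h N) G₀, (liouville G : ℂ)‖ ^ 2 ≤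
      C * ((N : ℝ) ^ 5 / (h N : ℝ) ^ 2) * (Fintype.card Fq : ℝ) ^ (h N) := by
  have hq1 : (1 : ℝ) < (Fintype.card Fq : ℝ) := by exact_mod_cast Fintype.one_lt_card
  have hlog : 0 < Real.log (Fintype.card Fq : ℝ) := Real.log_pos hq1
  obtain ⟨K, hK, h0, hsm⟩ := LV.smooth_bound Fq (A ^ 2 * Real.log (Fintype.card Fq : ℝ)) (by positivity)
  set q : ℝ := (Fintype.card Fq : ℝ) with hq
  refine ⟨q ^ 2 + 50 * q + 2 * K * q ^ 2, by positivity, ?_⟩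
  filter_upwards [hinf.eventually_ge_atTop (max h0 1), eventually_ge_atTop (⌈4 * A ^ 2⌉₊ + 2)] with N hN1 hN2
  have hh0 : h0 ≤ h N := le_trans (le_max_left _ _) hN1
  have hh1 : 1 ≤ h N := le_trans (le_max_right _ _) hN1
  have hb := hbd N
  generalize h N = k at *
  have hk1 : (1 : ℝ) ≤ k := by exact_mod_cast hh1
  have hN2' : (2 : ℝ) ≤ N := by
    have : 2 ≤ N := by omega
    exact_mod_cast this
  have hNA : 4 * A ^ 2 ≤ N := by
    refine (Nat.le_ceil _).trans ?_
    have : ⌈4 * A ^ 2⌉₊ ≤ N := by omega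
    exact_mod_cast this
  have hs : Real.sqrt N ^ 2 = N := Real.sq_sqrt (by positivity)
  have hs0 : 0 ≤ Real.sqrt N := Real.sqrt_nonneg _
  have hksq : (k : ℝ) ^ 2 ≤ A ^ 2 * N := by
    rw [← hs, ← mul_pow]
    gcongr
  have hkN : 2 * k ≤ N := by
    have h1 : 2 * A ≤ Real.sqrt N := by
      apply Real.le_sqrt_of_sq_le
      nlinarith
    have : (2 : ℝ) * k ≤ N := by
      nlinarith
    exact_mod_cast this
  have hm : N = (N - (k + 1)) + (k + 1) := by omega
  have hmain := LV.main_bound (F := Fq) (m := N - (k + 1)) k N hh1 hm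
  rw [← hq] at hmain
  refine hmain.trans ?_
  have hsm' := hsm k hh0 N
  have hm4 : (((N - (k + 1) : ℕ) : ℝ) + 4) ≤ 5 * N := by
    have : ((N - (k + 1) : ℕ) : ℝ) ≤ N := by exact_mod_cast Nat.sub_le _ _
    linarith
  have hqm : 1 ≤ q ^ (N - (k + 1)) := one_le_pow₀ hq1.le
  have hkN' : (k : ℝ) ≤ N := by
    have : k ≤ N := by omega
    exact_mod_cast this
  have hR : 1 ≤ (N : ℝ) ^ 5 / (k : ℝ) ^ 2 := by
    rw [one_le_div (by positivity)]
    calc (k : ℝ) ^ 2 ≤ (N : ℝ) ^ 2 := by gcongr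
      _ ≤ (N : ℝ) ^ 5 := pow_le_pow_right₀ (by linarith) (by norm_num)
  set R : ℝ := (N : ℝ) ^ 5 / (k : ℝ) ^ 2 with hRdef
  have t1 : q / q ^ (N - (k + 1)) ≤ q * R := by
    calc q / q ^ (N - (k + 1)) ≤ q := div_le_self (by linarith) hqm
      _ ≤ q * R := le_mul_of_one_le_right (by linarith) hR
  have t2 : 2 * ((N : ℝ) ^ 2 * (((N - (k + 1) : ℕ) : ℝ) + 4) ^ 2 / (k : ℝ) ^ 2) ≤ 50 * R := by
    calc _ ≤ 2 * ((N : ℝ) ^ 2 * (5 * N) ^ 2 / (k : ℝ) ^ 2) := by gcongr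
      _ = 50 * ((N : ℝ) ^ 4 / (k : ℝ) ^ 2) := by ring
      _ ≤ 50 * R := by
        rw [hRdef]
        gcongr
        · linarith
        · norm_num
  have hexp : Real.exp (-(A ^ 2 * Real.log q * N / k)) ≤ 1 / q ^ k := by
    have h1 : Real.exp (-(k * Real.log q)) = 1 / q ^ k := by
      rw [Real.exp_neg, Real.exp_nat_mul, Real.exp_log (by linarith), one_div]
    rw [← h1]
    apply Real.exp_le_exp.2
    apply neg_le_neg
    rw [le_div_iff₀ (by linarith)]
    nlinarith
  have t4 : 2 * (q ^ (k + 1) * (LV.sN Fq k N / q ^ N)) ≤ 2 * K * q * R := by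
    calc _ ≤ 2 * (q ^ (k + 1) * (K * q ^ N * (1 / q ^ k) / q ^ N)) := by
          gcongr
          exact hsm'.trans (by gcongr)
      _ = 2 * K * q := by rw [pow_succ]; field_simp
      _ ≤ _ := le_mul_of_one_le_right (by positivity) hR
  calc _ ≤ q ^ (k + 1) * (q * R + 50 * R + 2 * K * q * R) := by gcongr
    _ = _ := by rw [pow_succ]; ring
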